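/- arXiv:1811.09477 — 3 statements merged into one kernel-verified Lean document; each statement's English description precedes it below -/
import Mathlib

section
/- In the semiprimitive case, except when γ, p, and (p^j+1)/N are all odd, the Gaussian periods of order N over F_q satisfy η_0^{(N,q)} = ((−1)^{γ+1}(N−1)√q − 1)/N and η_i^{(N,q)} = ((−1)^γ √q − 1)/N for all i ≠ 0. -/
open scoped Classical

/-- The canonical additive character of a finite field `F` of characteristic `p`. -/
noncomputable def canChar (p : ℕ) (F : Type*) [Field F] [Fintype F] [Algebra (ZMod p) F]
    (x : F) : ℂ :=
  Complex.exp (2 * Real.pi * Complex.I * ((Algebra.trace (ZMod p) F x).val : ℂ) / p)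

/-- Gaussian period `η_i^{(N,q)}` of order `N` w.r.t. primitive element `α`. -/
noncomputable def gaussPeriod (p : ℕ) (F : Type*) [Field F] [Fintype F]
    [Algebra (ZMod p) F] (α : F) (N i : ℕ) : ℂ :=
  ∑ x : F, if ∃ k : ℕ, x = α ^ i * (α ^ N) ^ k then canChar p F x else 0

theorem sum_range_mul_aux (A B : ℕ) (g : ℕ → ℂ) :
    ∑ m ∈ Finset.range (A * B), g m
      = ∑ a ∈ Finset.range A, ∑ b ∈ Finset.range B, g (a + A * b) := by
  rw [Finset.sum_comm]
  induction B with
  | zero => simp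
  | succ B ih =>
    rw [Nat.mul_succ, Finset.sum_range_add, ih, Finset.sum_range_succ]
    congr 1
    exact Finset.sum_congr rfl fun a _ => by rw [add_comm]

/-- The canonical character as an additive character. -/
noncomputable def psiChar (p : ℕ) [Fact p.Prime] (F : Type*) [Field F] [Fintype F]
    [Algebra (ZMod p) F] : AddChar F ℂ :=
  (ZMod.stdAddChar (N := p)).compAddMonoidHom (Algebra.trace (ZMod p) F).toAddMonoidHom

section chars
variable (p : ℕ) [Fact p.Prime] (F : Type*) [Field F] [Fintype F] [Algebra (ZMod p) F]

theorem psiChar_apply (x : F) :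
    psiChar p F x = ZMod.stdAddChar (N := p) (Algebra.trace (ZMod p) F x) := rfl

theorem canChar_eq (x : F) : canChar p F x = psiChar p F x := by
  rw [psiChar_apply, ZMod.stdAddChar_apply, ZMod.toCircle_apply]
  rfl

theorem psiChar_prim : (psiChar p F).IsPrimitive := by
  apply AddChar.IsPrimitive.of_ne_one
  intro h
  obtain ⟨x, hx⟩ := Algebra.trace_surjective (ZMod p) F 1
  have h1 : psiChar p F x = 1 := by rw [h]; rfl
  rw [psiChar_apply, hx, ← AddChar.map_zero_eq_one (ZMod.stdAddChar (N := p))] at h1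
  exact one_ne_zero (ZMod.injective_stdAddChar h1)

theorem psiChar_pow_p (x : F) : psiChar p F x ^ p = 1 := by
  rw [psiChar_apply, ← AddChar.map_nsmul_eq_pow]
  simp

theorem psiChar_integral (x : F) : IsIntegral ℤ (psiChar p F x) :=
  IsIntegral.of_pow (Nat.Prime.pos Fact.out) (by rw [psiChar_pow_p]; exact isIntegral_one)

theorem psiChar_frob (x : F) : psiChar p F (x ^ p) = psiChar p F x := by
  rw [psiChar_apply, psiChar_apply]
  congr 1
  have := Algebra.trace_eq_of_algEquiv (FiniteField.frobeniusAlgEquivOfAlgebraic (ZMod p) F) x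
  rw [← this]
  simp

theorem psiChar_frob_pow (j : ℕ) (x : F) : psiChar p F (x ^ p ^ j) = psiChar p F x := by
  induction j with
  | zero => simp
  | succ j ih => rw [pow_succ, pow_mul, psiChar_frob, ih]

theorem psiChar_one (j γ : ℕ) (hc : Fintype.card F = p ^ (2 * j * γ)) (w : F)
    (hw : w ^ p ^ j = -w) : psiChar p F w = 1 := by
  have hp : p.Prime := Fact.out
  have : CharP F p := charP_of_injective_algebraMap' (ZMod p) p
  rcases hp.eq_two_or_odd with h2 | hodd
  · subst h2
    have hw2 : w ^ 2 ^ j = w := by rw [hw, CharTwo.neg_eq]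
    have hit : ∀ g : ℕ, w ^ 2 ^ (j * g) = w := by
      intro g
      induction g with
      | zero => simp
      | succ g ih => rw [Nat.mul_succ, pow_add, pow_mul, ih, hw2]
    have hfr : Module.finrank (ZMod 2) F = j * γ + j * γ := by
      have := Module.card_eq_pow_finrank (K := ZMod 2) (V := F)
      rw [hc, ZMod.card] at this
      have := Nat.pow_right_injective le_rfl this
      rw [← this]; ring
    have ht : algebraMap (ZMod 2) F (Algebra.trace (ZMod 2) F w) = 0 := by
      rw [FiniteField.algebraMap_trace_eq_sum_pow, hfr, Finset.sum_range_add, Nat.card_zmod]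
      have : ∀ x, w ^ 2 ^ (j * γ + x) = w ^ 2 ^ x := by
        intro x; rw [pow_add, pow_mul, hit]
      simp_rw [this]
      exact CharTwo.add_self_eq_zero _
    rw [psiChar_apply, (map_eq_zero _).1 ht, AddChar.map_zero_eq_one]
  · have h1 : psiChar p F w * psiChar p F w = 1 := by
      nth_rw 1 [← psiChar_frob_pow p F j w]
      rw [hw, ← AddChar.map_add_eq_mul]; simp
    have h3 := psiChar_pow_p p F w
    obtain ⟨k, hk⟩ : Odd p := Nat.odd_iff.2 hodd
    have h4 : psiChar p F w ^ (2 * k + 1) = 1 := hk ▸ h3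
    rw [pow_succ, pow_mul, sq, h1] at h4
    simpa using h4

end chars

section main
variable {F : Type*} [Field F] [Fintype F]

/-- the power sum -/
noncomputable def SS (ψ : AddChar F ℂ) (Q : ℕ) (a : F) : ℂ := ∑ y : F, ψ (a * y ^ (Q + 1))

theorem SS_sq (ψ : AddChar F ℂ) (hψ : ψ.IsPrimitive) (Q : ℕ)
    (hadd : ∀ x y : F, (x + y) ^ Q = x ^ Q + y ^ Q) (hinj : Function.Injective fun x : F => x ^ Q)
    (hfr : ∀ x, ψ (x ^ Q) = ψ x) (h1 : ∀ w : F, w ^ Q = -w → ψ w = 1)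
    (u : F) (hu : u ^ (Q + 1) = -1) (a : F) :
    SS ψ Q a ^ 2 = Fintype.card F *
      ((Finset.univ.filter fun t : F => a * t + a ^ Q * (t ^ Q) ^ Q = 0).card : ℂ) := by
  have hu0 : u ≠ 0 := by rintro rfl; simp at hu
  have hneg : SS ψ Q a = ∑ y : F, ψ (- (a * y ^ (Q + 1))) := by
    unfold SS
    rw [← Equiv.sum_comp (Equiv.mulLeft₀ u hu0)]
    refine Finset.sum_congr rfl fun y _ => ?_
    change ψ (a * (u * y) ^ (Q + 1)) = _
    rw [mul_pow, hu]
    congr 1; ring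
  have hbij : Function.Bijective fun x : F => x ^ Q := Finite.injective_iff_bijective.1 hinj
  have hin : ∀ t : F, ∑ y : F, ψ (a * (y + t) ^ (Q + 1)) * ψ (- (a * y ^ (Q + 1)))
      = if a * t + a ^ Q * (t ^ Q) ^ Q = 0 then (Fintype.card F : ℂ) else 0 := by
    intro t
    have e1 : ∀ y : F, ψ (a * (y + t) ^ (Q + 1)) * ψ (- (a * y ^ (Q + 1)))
        = ψ (a * t ^ (Q + 1)) * ψ (y ^ Q * (a * t + a ^ Q * (t ^ Q) ^ Q)) := by
      intro y
      have : ψ (y ^ Q * (a * t + a ^ Q * (t ^ Q) ^ Q))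
          = ψ (y ^ Q * (a * t)) * ψ (y * a * t ^ Q) := by
        rw [← hfr (y * a * t ^ Q), ← AddChar.map_add_eq_mul]
        congr 1; rw [mul_pow, mul_pow]; ring
      rw [this, ← AddChar.map_add_eq_mul, ← AddChar.map_add_eq_mul, ← AddChar.map_add_eq_mul]
      congr 1
      rw [pow_succ, hadd]; ring
    rw [Finset.sum_congr rfl fun y _ => e1 y, ← Finset.mul_sum,
      hbij.sum_comp (fun z => ψ (z * (a * t + a ^ Q * (t ^ Q) ^ Q))), AddChar.sum_mulShift _ hψ]
    split_ifs with h
    · rw [h1, one_mul]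
      rw [mul_pow, pow_succ, mul_pow]
      linear_combination t ^ Q * h
    · simp
  calc SS ψ Q a ^ 2 = SS ψ Q a * ∑ y : F, ψ (- (a * y ^ (Q + 1))) := by rw [← hneg, sq]
    _ = ∑ y : F, ∑ z : F, ψ (a * z ^ (Q + 1)) * ψ (- (a * y ^ (Q + 1))) := by
      rw [SS, Finset.sum_mul_sum, Finset.sum_comm]
    _ = ∑ y : F, ∑ t : F, ψ (a * (y + t) ^ (Q + 1)) * ψ (- (a * y ^ (Q + 1))) := by
      refine Finset.sum_congr rfl fun y _ => ?_
      rw [← Equiv.sum_comp (Equiv.addLeft y)]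
      rfl
    _ = _ := by
      rw [Finset.sum_comm, Finset.sum_congr rfl fun t _ => hin t, ← Finset.sum_filter,
        Finset.sum_const, nsmul_eq_mul, mul_comm]

theorem dvd_of_integral (d m : ℤ) (hd : d ≠ 0) (x : ℂ) (hx : IsIntegral ℤ x)
    (h : (d : ℂ) * x = m) : d ∣ m := by
  have hd' : (d : ℚ) ≠ 0 := by exact_mod_cast hd
  have hd'' : (d : ℂ) ≠ 0 := by exact_mod_cast hd
  have hxe : x = algebraMap ℚ ℂ ((m : ℚ) / d) := by
    simp only [eq_ratCast, Rat.cast_div, Rat.cast_intCast]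
    rw [eq_div_iff hd'']; rw [← h]; ring
  rw [hxe, isIntegral_algebraMap_iff (algebraMap ℚ ℂ).injective] at hx
  obtain ⟨y, hy⟩ := IsIntegrallyClosed.isIntegral_iff.1 hx
  refine ⟨y, ?_⟩
  simp only [eq_intCast] at hy
  rw [eq_div_iff hd'] at hy
  have : y * d = m := by exact_mod_cast hy
  rw [← this]; ring

theorem sign_aux (Q e : ℕ) (hQ : 2 ≤ Q) (S x : ℂ) (hx : IsIntegral ℤ x)
    (hS : S = 1 + ((Q + 1 : ℕ) : ℂ) * x) (hsq : S ^ 2 = ((Q : ℂ) ^ e) ^ 2) :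
    S = (-1) ^ e * (Q : ℂ) ^ e := by
  have key : (((Q + 1 : ℕ) : ℤ)) ∣ (-1) ^ e * (Q : ℤ) ^ e - 1 := by
    rw [← mul_pow]
    have := sub_dvd_pow_sub_pow (-1 * (Q : ℤ)) 1 e
    rw [one_pow] at this
    refine dvd_trans ⟨-1, ?_⟩ this
    push_cast; ring
  have key2 : S = -((-1) ^ e * (Q : ℂ) ^ e) → False := by
    intro h
    have h1 : (((Q + 1 : ℕ) : ℤ) : ℂ) * x = ((-((-1) ^ e * (Q : ℤ) ^ e) - 1 : ℤ) : ℂ) := by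
      push_cast
      push_cast at hS
      rw [h] at hS
      linear_combination -hS
    have h2 := dvd_of_integral _ _ (by positivity) x hx h1
    have h3 := dvd_add key h2
    have h4 : (((Q + 1 : ℕ) : ℤ)) ∣ 2 := by
      rw [← dvd_neg]; convert h3 using 1; ring
    have := Int.le_of_dvd (by norm_num) h4
    push_cast at this
    omega
  rcases sq_eq_sq_iff_eq_or_eq_neg.1 hsq with h | h
  · rcases Nat.even_or_odd e with he | ho
    · rw [h, he.neg_one_pow, one_mul]
    · exact (key2 (by rw [h, ho.neg_one_pow]; ring)).elim
  · rcases Nat.even_or_odd e with he | ho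
    · exact (key2 (by rw [h, he.neg_one_pow]; ring)).elim
    · rw [h, ho.neg_one_pow]; ring

theorem sum_field (α : F) (n : ℕ) (hprim : IsPrimitiveRoot α n)
    (hα : ∀ x : F, x ≠ 0 → ∃ k : ℕ, x = α ^ k) (hn : 0 < n) (hα0 : α ≠ 0) (g : F → ℂ) :
    ∑ x : F, g x = g 0 + ∑ k ∈ Finset.range n, g (α ^ k) := by
  rw [← Finset.add_sum_erase _ _ (Finset.mem_univ (0 : F))]
  congr 1
  symm
  refine Finset.sum_bij (fun k _ => α ^ k) ?_ ?_ ?_ ?_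
  · intro k _
    simp [hα0]
  · intro a ha b hb h
    exact hprim.pow_inj (Finset.mem_range.1 ha) (Finset.mem_range.1 hb) h
  · intro x hx
    obtain ⟨k, rfl⟩ := hα x (Finset.ne_of_mem_erase hx)
    exact ⟨k % n, Finset.mem_range.2 (Nat.mod_lt _ hn), by
      rw [hprim.eq_orderOf, pow_mod_orderOf]⟩
  · intros; rfl

theorem pow_add_mul_eq (α : F) (n : ℕ) (hprim : IsPrimitiveRoot α n) (i N n' : ℕ)
    (hnn : n = N * n') (a b : ℕ) : α ^ (i + N * (a + n' * b)) = α ^ (i + N * a) := by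
  have : i + N * (a + n' * b) = (i + N * a) + n * b := by rw [hnn]; ring
  rw [this, pow_add, pow_mul α n, hprim.pow_eq_one, one_pow, mul_one]

theorem period_eq (ψ : F → ℂ) (α : F) (n : ℕ) (hprim : IsPrimitiveRoot α n) (hα0 : α ≠ 0)
    (hn : 0 < n) (N n' i : ℕ) (hnn : n = N * n') :
    (∑ x : F, if ∃ k : ℕ, x = α ^ i * (α ^ N) ^ k then ψ x else 0)
      = ∑ k ∈ Finset.range n', ψ (α ^ (i + N * k)) := by
  have hn' : 0 < n' := Nat.pos_of_ne_zero (by rintro rfl; simp at hnn; omega)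
  have hN : 0 < N := Nat.pos_of_ne_zero (by rintro rfl; simp at hnn; omega)
  rw [← Finset.sum_filter]
  symm
  refine Finset.sum_bij (fun k _ => α ^ (i + N * k)) ?_ ?_ ?_ ?_
  · intro k _
    simp only [Finset.mem_filter, Finset.mem_univ, true_and]
    exact ⟨k, by rw [pow_add, pow_mul]⟩
  · intro a ha b hb h
    rw [pow_add, pow_add] at h
    have h := mul_left_cancel₀ (pow_ne_zero i hα0) h
    have h3 := hprim.pow_inj ?_ ?_ h
    · exact Nat.eq_of_mul_eq_mul_left hN h3
    · rw [hnn]; exact Nat.mul_lt_mul_of_pos_left (Finset.mem_range.1 ha) hN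
    · rw [hnn]; exact Nat.mul_lt_mul_of_pos_left (Finset.mem_range.1 hb) hN
  · intro x hx
    simp only [Finset.mem_filter, Finset.mem_univ, true_and] at hx
    obtain ⟨k, rfl⟩ := hx
    refine ⟨k % n', Finset.mem_range.2 (Nat.mod_lt _ hn'), ?_⟩
    rw [← pow_mul, ← pow_add, ← pow_add_mul_eq α n hprim i N n' hnn (k % n') (k / n'),
      Nat.mod_add_div]
  · intros; rfl

theorem SS_eq (ψ : AddChar F ℂ) (α : F) (n : ℕ) (hprim : IsPrimitiveRoot α n)
    (hα : ∀ x : F, x ≠ 0 → ∃ k : ℕ, x = α ^ k) (hn : 0 < n) (hα0 : α ≠ 0)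
    (Q n' i : ℕ) (hnn : n = (Q + 1) * n') :
    SS ψ Q (α ^ i) = 1 + ((Q + 1 : ℕ) : ℂ) *
      ∑ k ∈ Finset.range n', ψ (α ^ (i + (Q + 1) * k)) := by
  unfold SS
  rw [sum_field α n hprim hα hn hα0]
  congr 1
  · simp
  · have h1 : ∀ k, ψ (α ^ i * (α ^ k) ^ (Q + 1)) = ψ (α ^ (i + (Q + 1) * k)) := by
      intro k; congr 1; ring
    simp_rw [h1]
    have h2 : n = n' * (Q + 1) := by rw [hnn]; ring
    have h3 : Finset.range n = Finset.range (n' * (Q + 1)) := by rw [h2]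
    rw [h3, sum_range_mul_aux]
    simp_rw [pow_add_mul_eq α n hprim i (Q + 1) n' hnn]
    simp only [Finset.sum_const, Finset.card_range, nsmul_eq_mul, Finset.mul_sum]

theorem exists_pow (α : F) (n : ℕ) (hprim : IsPrimitiveRoot α n)
    (hα : ∀ x : F, x ≠ 0 → ∃ k : ℕ, x = α ^ k)
    (Q m : ℕ) (hQ : 2 ≤ Q) (hnm : n = (Q - 1) * ((Q + 1) * m)) (w : F) (hw0 : w ≠ 0)
    (hw : w ^ (Q - 1) = 1) : ∃ k, w = α ^ ((Q + 1) * k) := by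
  obtain ⟨t, rfl⟩ := hα w hw0
  rw [← pow_mul, hprim.pow_eq_one_iff_dvd, hnm, mul_comm t] at hw
  have := Nat.dvd_of_mul_dvd_mul_left (by omega) hw
  obtain ⟨k, hk⟩ := dvd_trans (Dvd.intro _ rfl) this
  exact ⟨k, by rw [hk]⟩

theorem K_iff (Q : ℕ) (hQ : 2 ≤ Q) (a t : F) (ha : a ≠ 0) (ht : t ≠ 0) :
    a * t + a ^ Q * (t ^ Q) ^ Q = 0 ↔ (a * t ^ (Q + 1)) ^ (Q - 1) = -1 := by
  obtain ⟨r, rfl⟩ : ∃ r, Q = r + 1 := ⟨Q - 1, by omega⟩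
  have h : a * t + a ^ (r + 1) * (t ^ (r + 1)) ^ (r + 1)
      = a * t * ((a * t ^ (r + 1 + 1)) ^ (r + 1 - 1) + 1) := by
    simp only [Nat.add_sub_cancel, mul_pow, mul_add, ← pow_mul]
    ring
  rw [h, mul_eq_zero, or_iff_right (mul_ne_zero ha ht), add_eq_zero_iff_eq_neg]

theorem cardK_one (Q : ℕ) (hQ : 2 ≤ Q) (a : F) (ha : a ≠ 0)
    (h : ∀ t : F, t ≠ 0 → (a * t ^ (Q + 1)) ^ (Q - 1) ≠ -1) :
    (Finset.univ.filter fun t : F => a * t + a ^ Q * (t ^ Q) ^ Q = 0).card = 1 := by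
  rw [Finset.card_eq_one]
  refine ⟨0, ?_⟩
  ext t
  simp only [Finset.mem_filter, Finset.mem_univ, true_and, Finset.mem_singleton]
  constructor
  · intro h1
    by_contra h2
    exact h t h2 ((K_iff Q hQ a t ha h2).1 h1)
  · rintro rfl
    have : Q ≠ 0 := by omega
    simp [this]

theorem cardK_sq (Q : ℕ) (hQ : 2 ≤ Q) (a : F) (ha : a ≠ 0) (t : F) (ht : t ≠ 0)
    (h : (a * t ^ (Q + 1)) ^ (Q - 1) = -1) (ζ : F) (hζ : IsPrimitiveRoot ζ (Q ^ 2 - 1)) :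
    (Finset.univ.filter fun t : F => a * t + a ^ Q * (t ^ Q) ^ Q = 0).card = Q ^ 2 := by
  have hQ2 : 4 ≤ Q ^ 2 := by nlinarith
  have hpos : 0 < Q ^ 2 - 1 := by omega
  have hK := (K_iff Q hQ a t ha ht).2 h
  have e1 : (Finset.univ.filter fun t : F => a * t + a ^ Q * (t ^ Q) ^ Q = 0)
      = (insert 0 (Polynomial.nthRootsFinset (Q ^ 2 - 1) (1 : F))).image fun s => t * s := by
    ext x
    simp only [Finset.mem_filter, Finset.mem_univ, true_and, Finset.mem_image, Finset.mem_insert,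
      Polynomial.mem_nthRootsFinset hpos]
    have key : ∀ s : F, a * (t * s) + a ^ Q * ((t * s) ^ Q) ^ Q = 0 ↔
        (s = 0 ∨ s ^ (Q ^ 2 - 1) = 1) := by
      intro s
      have e2 : (s ^ Q) ^ Q = s * s ^ (Q ^ 2 - 1) := by
        rw [← pow_mul, ← pow_succ']; congr 1; rw [← sq]; omega
      have e3 : a * (t * s) + a ^ Q * ((t * s) ^ Q) ^ Q
          = - (a * t) * (s * (s ^ (Q ^ 2 - 1) - 1)) := by
        rw [mul_pow, mul_pow, e2]
        linear_combination s * s ^ (Q ^ 2 - 1) * hK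
      rw [e3, mul_eq_zero, mul_eq_zero, sub_eq_zero,
        or_iff_right (neg_ne_zero.2 (mul_ne_zero ha ht))]
    constructor
    · intro hx
      refine ⟨t⁻¹ * x, (key _).1 ?_, ?_⟩
      · rwa [mul_inv_cancel_left₀ ht]
      · rw [mul_inv_cancel_left₀ ht]
    · rintro ⟨s, hs, rfl⟩
      exact (key s).2 hs
  rw [e1, Finset.card_image_of_injective _ (mul_right_injective₀ ht),
    Finset.card_insert_of_notMem, hζ.card_nthRootsFinset]
  · omega
  · rw [Polynomial.mem_nthRootsFinset hpos, zero_pow hpos.ne']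
    exact zero_ne_one

/-- Value of the period of order `Q + 1`. -/
theorem eta_val (ψ : AddChar F ℂ) (hψ : ψ.IsPrimitive) (Q γ m n : ℕ) (hQ : 2 ≤ Q)
    (hadd : ∀ x y : F, (x + y) ^ Q = x ^ Q + y ^ Q) (hinj : Function.Injective fun x : F => x ^ Q)
    (hfr : ∀ x, ψ (x ^ Q) = ψ x) (h1 : ∀ w : F, w ^ Q = -w → ψ w = 1)
    (hint : ∀ x, IsIntegral ℤ (ψ x))
    (hneg : (-1 : F) ^ (Q - 1) = 1)
    (α : F) (hprim : IsPrimitiveRoot α n)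
    (hα : ∀ x : F, x ≠ 0 → ∃ k : ℕ, x = α ^ k) (hn : 0 < n) (hα0 : α ≠ 0)
    (hnm : n = (Q - 1) * ((Q + 1) * m)) (hcard : Fintype.card F = Q ^ (2 * γ))
    (c : ℕ) (hc : (α ^ c) ^ (Q - 1) = -1) (i : ℕ) :
    1 + ((Q + 1 : ℕ) : ℂ) * ∑ k ∈ Finset.range ((Q - 1) * m), ψ (α ^ (i + (Q + 1) * k))
      = if i ≡ c [MOD Q + 1] then (-1) ^ (γ + 1) * (Q : ℂ) ^ (γ + 1)
        else (-1) ^ γ * (Q : ℂ) ^ γ := by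
  have hnn : n = (Q + 1) * ((Q - 1) * m) := by rw [hnm]; ring
  have hS := SS_eq ψ α n hprim hα hn hα0 Q _ i hnn
  have hI : IsIntegral ℤ (∑ k ∈ Finset.range ((Q - 1) * m), ψ (α ^ (i + (Q + 1) * k))) :=
    IsIntegral.sum _ fun k _ => hint _
  obtain ⟨u, hu⟩ := exists_pow α n hprim hα Q m hQ hnm (-1) (by simp) hneg
  have hsq := SS_sq ψ hψ Q hadd hinj hfr h1 (α ^ u) (by rw [hu, ← pow_mul, mul_comm]) (α ^ i)
  have ha : α ^ i ≠ 0 := pow_ne_zero _ hα0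
  rw [← hS]
  have hdvd : Q + 1 ∣ n := ⟨_, hnn⟩
  split_ifs with hic
  · have ht : ∃ t : F, t ≠ 0 ∧ (α ^ i * t ^ (Q + 1)) ^ (Q - 1) = -1 := by
      obtain ⟨s, hs⟩ : Q + 1 ∣ c + n * i - i := by
        refine (Nat.modEq_iff_dvd' ?_).1 ?_
        · nlinarith
        · refine hic.trans ?_
          have : n * i ≡ 0 [MOD Q + 1] := (Nat.modEq_zero_iff_dvd).2 (hdvd.mul_right _)
          simpa using (this.add_left c).symm
      have hs' : i + (Q + 1) * s = c + n * i := by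
        have : i ≤ c + n * i := by nlinarith
        omega
      refine ⟨α ^ s, pow_ne_zero _ hα0, ?_⟩
      rw [← pow_mul, mul_comm s, ← pow_add, hs', pow_add, pow_mul α n, hprim.pow_eq_one, one_pow,
        mul_one, hc]
    obtain ⟨t, ht0, ht⟩ := ht
    have hζ : IsPrimitiveRoot (α ^ m) (Q ^ 2 - 1) := by
      refine hprim.pow hn ?_
      rw [hnm]
      have : Q ^ 2 - 1 = (Q + 1) * (Q - 1) := by
        simpa using Nat.sq_sub_sq Q 1
      rw [this]; ring
    rw [cardK_sq Q hQ _ ha t ht0 ht _ hζ, hcard] at hsq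
    refine sign_aux Q (γ + 1) hQ _ _ hI hS ?_
    rw [hsq]; push_cast; ring
  · rw [cardK_one Q hQ _ ha, hcard] at hsq
    · refine sign_aux Q γ hQ _ _ hI hS ?_
      rw [hsq]; push_cast; ring
    · intro t ht0 ht
      apply hic
      obtain ⟨s, rfl⟩ := hα t ht0
      have hw : (α ^ i * (α ^ s) ^ (Q + 1) / α ^ c) ^ (Q - 1) = 1 := by
        rw [div_pow, ht, hc]; simp
      obtain ⟨k, hk⟩ := exists_pow α n hprim hα Q m hQ hnm _
        (div_ne_zero (mul_ne_zero ha (pow_ne_zero _ ht0)) (pow_ne_zero _ hα0)) hw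
      rw [div_eq_iff (pow_ne_zero _ hα0), ← pow_mul, ← pow_add, ← pow_add] at hk
      have hmod : ∀ k, α ^ (k % n) = α ^ k := fun k => by
        rw [hprim.eq_orderOf, pow_mod_orderOf]
      rw [← hmod (i + _), ← hmod (_ + c)] at hk
      have hk := hprim.pow_inj (Nat.mod_lt _ hn) (Nat.mod_lt _ hn) hk
      have hk : i + s * (Q + 1) ≡ (Q + 1) * k + c [MOD Q + 1] := Nat.ModEq.of_dvd hdvd hk
      unfold Nat.ModEq at hk ⊢
      simpa using hk

/-- Assemble the periods of order `N`. -/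
theorem combine (f : ℕ → ℂ) (Q γ N M n' c i : ℕ) (hM : Q + 1 = N * M) (hi : i < N)
    (hc : N ∣ c)
    (h : ∀ i, 1 + ((Q + 1 : ℕ) : ℂ) * ∑ k ∈ Finset.range n', f (i + (Q + 1) * k)
      = if i ≡ c [MOD Q + 1] then (-1) ^ (γ + 1) * (Q : ℂ) ^ (γ + 1)
        else (-1) ^ γ * (Q : ℂ) ^ γ) :
    ∑ k ∈ Finset.range (M * n'), f (i + N * k) =
      if i = 0 then ((-1 : ℂ) ^ (γ + 1) * ((N : ℂ) - 1) * (Q : ℂ) ^ γ - 1) / N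
      else ((-1 : ℂ) ^ γ * (Q : ℂ) ^ γ - 1) / N := by
  have hM0 : 0 < M := Nat.pos_of_ne_zero (by rintro rfl; simp at hM)
  have hN0 : 0 < N := by omega
  have hQ1 : ((Q + 1 : ℕ) : ℂ) ≠ 0 := by exact_mod_cast Nat.succ_ne_zero Q
  have hNc : (N : ℂ) ≠ 0 := by exact_mod_cast hN0.ne'
  have hMc : (M : ℂ) ≠ 0 := by exact_mod_cast hM0.ne'
  have hMC : (Q : ℂ) + 1 = N * M := by exact_mod_cast hM
  rw [sum_range_mul_aux]
  have e1 : ∀ a b, i + N * (a + M * b) = (i + N * a) + (Q + 1) * b := by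
    intro a b; rw [hM]; ring
  simp_rw [e1]
  have e2 : ∀ a, ∑ b ∈ Finset.range n', f ((i + N * a) + (Q + 1) * b)
      = ((-1) ^ γ * (Q : ℂ) ^ γ - 1) / ((Q + 1 : ℕ) : ℂ)
        + if i + N * a ≡ c [MOD Q + 1] then - ((-1) ^ γ * (Q : ℂ) ^ γ) else 0 := by
    intro a
    have := h (i + N * a)
    split_ifs at this ⊢ with h1
    · rw [← sub_eq_iff_eq_add, eq_div_iff hQ1]
      push_cast at this ⊢
      linear_combination this
    · rw [add_zero, eq_div_iff hQ1]
      linear_combination this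
  simp_rw [e2]
  rw [Finset.sum_add_distrib, Finset.sum_const, Finset.card_range, nsmul_eq_mul]
  obtain ⟨d, rfl⟩ := hc
  split_ifs with hi0
  · subst hi0
    have e3 : ∀ a ∈ Finset.range M, (if 0 + N * a ≡ N * d [MOD Q + 1] then
        - ((-1) ^ γ * (Q : ℂ) ^ γ) else 0)
        = if d % M = a then - ((-1) ^ γ * (Q : ℂ) ^ γ) else 0 := by
      intro a ha
      congr 1
      rw [zero_add, hM, eq_iff_iff]
      constructor
      · intro hh
        have := Nat.ModEq.mul_left_cancel' hN0.ne' hh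
        rw [← this, Nat.mod_eq_of_lt (Finset.mem_range.1 ha)]
      · rintro rfl
        exact Nat.ModEq.mul_left' N (Nat.mod_modEq d M)
    rw [Finset.sum_congr rfl e3, Finset.sum_ite_eq,
      if_pos (Finset.mem_range.2 (Nat.mod_lt _ hM0))]
    push_cast
    rw [hMC]
    field_simp
    ring
  · rw [Finset.sum_eq_zero]
    · push_cast
      rw [hMC]
      field_simp
      ring
    · intro a _
      rw [if_neg]
      intro hh
      have h5 : i + N * a ≡ N * d [MOD N] := Nat.ModEq.of_dvd (hM ▸ Dvd.intro _ rfl) hh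
      unfold Nat.ModEq at h5
      simp [Nat.mod_eq_of_lt hi] at h5
      exact hi0 h5

end main

/-- The semiprimitive case, part (b): except when `γ, p, (p^j+1)/N` are all odd,
`η_0^{(N,q)} = ((−1)^{γ+1}(N−1)√q − 1)/N` and `η_i^{(N,q)} = ((−1)^γ√q − 1)/N`
for all `i ≠ 0`. -/
theorem stmt4 (p j γ N q : ℕ) (hp : p.Prime) (hN : 2 ≤ N)
    (hj : 0 < j) (hγ : 0 < γ)
    (F : Type*) [Field F] [Fintype F] [Algebra (ZMod p) F]
    (hq : q = Fintype.card F) (hqs : q = p ^ (2 * j * γ))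
    (hNdvd : N ∣ p ^ j + 1)
    (hjmin : ∀ j' : ℕ, 0 < j' → N ∣ p ^ j' + 1 → j ≤ j')
    (α : F) (hα : ∀ x : F, x ≠ 0 → ∃ k : ℕ, x = α ^ k)
    (hnotall : ¬(Odd γ ∧ Odd p ∧ Odd ((p ^ j + 1) / N))) :
    gaussPeriod p F α N 0 =
      ((-1 : ℂ) ^ (γ + 1) * ((N : ℂ) - 1) * (Real.sqrt q : ℂ) - 1) / N ∧
    ∀ i : ℕ, i < N → i ≠ 0 →
      gaussPeriod p F α N i = ((-1 : ℂ) ^ γ * (Real.sqrt q : ℂ) - 1) / N := by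
  have hfact : Fact p.Prime := ⟨hp⟩
  have hchar : CharP F p := charP_of_injective_algebraMap' (ZMod p) p
  have hcard : Fintype.card F = p ^ (2 * j * γ) := by rw [← hq, hqs]
  obtain ⟨Q, hQdef⟩ : ∃ Q, Q = p ^ j := ⟨_, rfl⟩
  have hQ : 2 ≤ Q := by
    rw [hQdef]; exact hp.two_le.trans (Nat.le_self_pow hj.ne' p)
  have hcardQ : Fintype.card F = Q ^ (2 * γ) := by
    rw [hcard, hQdef, ← pow_mul]; congr 1; ring
  have hcard4 : 4 ≤ Fintype.card F := by
    rw [hcardQ, pow_mul]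
    calc 4 ≤ Q ^ 2 := by nlinarith
      _ ≤ (Q ^ 2) ^ γ := Nat.le_self_pow hγ.ne' _
  have hα0 : α ≠ 0 := by
    rintro rfl
    have hsub : (Finset.univ : Finset F) ⊆ {0, 1} := by
      intro x _
      simp only [Finset.mem_insert, Finset.mem_singleton]
      by_cases hx : x = 0
      · exact Or.inl hx
      · obtain ⟨k, hk⟩ := hα x hx
        rcases Nat.eq_zero_or_pos k with rfl | hk0
        · right; simpa using hk
        · left; rw [hk, zero_pow hk0.ne']
    have h1 := Finset.card_le_card hsub
    rw [Finset.card_univ] at h1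
    have h2 := Finset.card_le_two (a := (0 : F)) (b := 1)
    omega
  obtain ⟨n, hndef⟩ : ∃ n, n = Fintype.card F - 1 := ⟨_, rfl⟩
  have hn : 0 < n := by omega
  have hprim : IsPrimitiveRoot α n := by
    have h1 : orderOf (Units.mk0 α hα0) = Nat.card Fˣ := by
      refine orderOf_eq_card_of_forall_mem_zpowers fun x => ?_
      obtain ⟨k, hk⟩ := hα x x.ne_zero
      refine ⟨k, ?_⟩
      ext
      simp [hk]
    have h2 : orderOf α = n := by
      rw [← Units.val_mk0 hα0, orderOf_units, h1, Nat.card_eq_fintype_card, Fintype.card_units,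
        hndef]
    rw [← h2]
    exact IsPrimitiveRoot.orderOf α
  obtain ⟨m, hmdef⟩ : ∃ m, m = ∑ k ∈ Finset.range γ, (Q ^ 2) ^ k := ⟨_, rfl⟩
  have hnm : n = (Q - 1) * ((Q + 1) * m) := by
    have h1 : Q ^ 2 - 1 = (Q + 1) * (Q - 1) := by simpa using Nat.sq_sub_sq Q 1
    have h2 := Nat.geomSum_eq (m := Q ^ 2) (by nlinarith) γ
    have h3 : Q ^ 2 - 1 ∣ (Q ^ 2) ^ γ - 1 := by
      simpa using Nat.sub_dvd_pow_sub_pow (Q ^ 2) 1 γ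
    rw [← hmdef] at h2
    have h4 := Nat.div_mul_cancel h3
    rw [← h2] at h4
    rw [hndef, hcardQ, pow_mul, ← h4, h1]; ring
  have hneg : (-1 : F) ^ (Q - 1) = 1 := by
    rcases hp.eq_two_or_odd' with h2 | hodd
    · subst h2
      rw [CharTwo.neg_eq, one_pow]
    · have : Even (Q - 1) := by
        rw [hQdef]; exact (hodd.pow).tsub_odd odd_one
      exact this.neg_one_pow
  obtain ⟨M, hM⟩ := hNdvd
  rw [← hQdef] at hM
  have hMdiv : (p ^ j + 1) / N = M := by
    rw [← hQdef, hM, Nat.mul_div_cancel_left _ (by omega)]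
  rw [hMdiv] at hnotall
  have hc : ∃ c, N ∣ c ∧ (α ^ c) ^ (Q - 1) = -1 := by
    rcases hp.eq_two_or_odd' with h2 | hodd
    · subst h2
      exact ⟨0, dvd_zero _, by simp [CharTwo.neg_eq]⟩
    · have hQo : Odd Q := by rw [hQdef]; exact hodd.pow
      have hexp : ∀ c, 2 * c = (Q + 1) * m → (α ^ c) ^ (Q - 1) = -1 := by
        intro c hc
        have h1 : n = (c * (Q - 1)) * 2 := by rw [hnm, ← hc]; ring
        have h2 := hprim.pow hn h1
        rw [← pow_mul]
        exact h2.eq_neg_one_of_two_right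
      by_cases hγo : Odd γ
      · have hMe : Even M := by
          rw [← Nat.not_odd_iff_even]; exact fun h => hnotall ⟨hγo, hodd, h⟩
        obtain ⟨d, hd⟩ := hMe
        refine ⟨N * (d * m), Dvd.intro _ rfl, hexp _ ?_⟩
        rw [hM, hd]; ring
      · have hme : Even m := by
          rw [hmdef, Finset.even_sum_iff_even_card_odd]
          have : Finset.filter (fun k => Odd ((Q ^ 2) ^ k)) (Finset.range γ)
              = Finset.range γ := Finset.filter_true_of_mem fun k _ => (hQo.pow).pow
          rw [this, Finset.card_range]
          exact Nat.not_odd_iff_even.1 hγo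
        obtain ⟨d, hd⟩ := hme
        refine ⟨N * (M * d), Dvd.intro _ rfl, hexp _ ?_⟩
        rw [hM, hd]; ring
  obtain ⟨c, hNc, hc⟩ := hc
  have hadd : ∀ x y : F, (x + y) ^ Q = x ^ Q + y ^ Q := by
    intro x y; rw [hQdef]; exact add_pow_char_pow ..
  have hinj : Function.Injective fun x : F => x ^ Q := by
    intro x y hxy
    have h1 : (x - y) ^ Q = 0 := by
      have h2 := hadd (x - y) y
      rw [sub_add_cancel] at h2
      have h3 : x ^ Q = y ^ Q := hxy
      rw [h3] at h2
      exact (right_eq_add.1 h2)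
    exact sub_eq_zero.1 (pow_eq_zero_iff (by omega) |>.1 h1)
  have hval := eta_val (psiChar p F) (psiChar_prim p F) Q γ m n hQ hadd hinj
    (fun x => by rw [hQdef]; exact psiChar_frob_pow p F j x)
    (fun w hw => psiChar_one p F j γ hcard w (by rw [← hQdef]; exact hw))
    (psiChar_integral p F) hneg α hprim hα hn hα0 hnm hcardQ c hc
  have hsqrt : (Real.sqrt q : ℂ) = (Q : ℂ) ^ γ := by
    have : Real.sqrt q = (Q : ℝ) ^ γ := by
      rw [hq, hcardQ, Real.sqrt_eq_iff_mul_self_eq (by positivity) (by positivity)]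
      push_cast; ring
    rw [this]; push_cast; rfl
  have hall : ∀ i, i < N → gaussPeriod p F α N i =
      if i = 0 then ((-1 : ℂ) ^ (γ + 1) * ((N : ℂ) - 1) * (Q : ℂ) ^ γ - 1) / N
      else ((-1 : ℂ) ^ γ * (Q : ℂ) ^ γ - 1) / N := by
    intro i hi
    unfold gaussPeriod
    simp_rw [canChar_eq]
    rw [period_eq (psiChar p F) α n hprim hα0 hn N (M * ((Q - 1) * m)) i
      (by rw [hnm, hM]; ring)]
    exact combine (fun k => psiChar p F (α ^ k)) Q γ N M ((Q - 1) * m) c i hM hi hNc hval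
  rw [hsqrt]
  refine ⟨?_, fun i hi hi0 => ?_⟩
  · rw [hall 0 (by omega), if_pos rfl]
  · rw [hall i hi, if_neg hi0]
end

section
/- If h = 2 (which forces m even), then C_K is a three-weight linear code of length 2nq^{m_1}, dimension m+m_1, and minimum distance (2nq^{m/2+m_1−1}(q−1)/(q^m−1))(q^{m/2}−1), with weight distribution: weight 2nq^{m_1−1}(q−1) with frequency q^{m_1+m}−q^m, weight (2nq^{m/2+m_1−1}(q−1)/(q^m−1))(q^{m/2}−1) with frequency (q^m−1)/2, and weight (2nq^{m/2+m_1−1}(q−1)/(q^m−1))(q^{m/2}+1) with frequency (q^m−1)/2. -/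
open scoped Classical

/-- The codeword `c(a,b)` of the code `C_K` with `K = F_{q^{m_1}} × D`,
`D = {ω^{hi} : 0 ≤ i < n}`:
`c(a,b) = (Tr^{m_1}_1(ax)+Tr^m_1(by) | Tr^{m_1}_1(ax)+Tr^m_1((a+b)y))_{(x,y) ∈ K}`,
indexed by `(x, i, half) ∈ E1 × Fin n × Bool` where `y = ω^{hi}`. -/
noncomputable def cword (Kq E1 E : Type*) [Field Kq] [Field E1] [Field E]
    [Algebra Kq E1] [Algebra Kq E] [Algebra E1 E]
    (ω : E) (h n : ℕ) (a : E1) (b : E) : E1 × Fin n × Bool → Kq :=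
  fun z =>
    if z.2.2 then
      Algebra.trace Kq E1 (a * z.1) + Algebra.trace Kq E (b * ω ^ (h * (z.2.1 : ℕ)))
    else
      Algebra.trace Kq E1 (a * z.1) +
        Algebra.trace Kq E ((algebraMap E1 E a + b) * ω ^ (h * (z.2.1 : ℕ)))


theorem aux_fiber (K F : Type*) [Field K] [Fintype K] [DecidableEq K] [Field F] [Fintype F] [Algebra K F]
    (a : F) (ha : a ≠ 0) (c : K) :
    (Finset.univ.filter fun x : F => Algebra.trace K F (a * x) = c).card * Fintype.card K
      = Fintype.card F := by
  let f : F →+ K := (Algebra.trace K F).toAddMonoidHom.comp (AddMonoidHom.mulLeft a)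
  have hf : Function.Surjective f := by
    intro k
    obtain ⟨x, hx⟩ := Algebra.trace_surjective K F k
    refine ⟨a⁻¹ * x, ?_⟩
    simp [f, ha, hx]
  have h1 : ∀ d : K, (Finset.univ.filter fun x : F => f x = d).card =
      (Finset.univ.filter fun x : F => f x = c).card := fun d =>
    AddMonoidHom.card_fiber_eq_of_mem_range f (hf d) (hf c)
  have h2 := Finset.card_eq_sum_card_fiberwise (f := f) (s := Finset.univ) (t := Finset.univ)
    (fun _ _ => by simp)
  simp only [h1, Finset.sum_const, Finset.card_univ, smul_eq_mul] at h2
  rw [h2, mul_comm]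
  rfl

theorem aux_fiber_ne (K F : Type*) [Field K] [Fintype K] [DecidableEq K] [Field F] [Fintype F] [Algebra K F]
    (a : F) (ha : a ≠ 0) (c : K) :
    (Finset.univ.filter fun x : F => Algebra.trace K F (a * x) + c ≠ 0).card * Fintype.card K
      = Fintype.card F * (Fintype.card K - 1) := by
  have h := aux_fiber K F a ha (-c)
  have h2 := Finset.card_filter_add_card_filter_not (s := (Finset.univ : Finset F))
    (fun x : F => Algebra.trace K F (a * x) + c = 0)
  simp only [eq_neg_iff_add_eq_zero] at h
  have h3 : 1 ≤ Fintype.card K := Fintype.card_pos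
  simp only [Finset.card_univ] at h2
  zify [h3] at *
  linear_combination (Fintype.card K : ℤ) * h2 - h

theorem aux_gauss (K F : Type*) [Field K] [Fintype K] [DecidableEq K] [Field F] [Fintype F] [Algebra K F]
    (Q : ℕ) (hQ : Fintype.card F = Q ^ 2) (h2 : ringChar F ≠ 2)
    (hc : ∀ c : K, c ≠ 0 → quadraticChar F (algebraMap K F c) = 1) :
    ∃ ε : ℤ, (ε = 1 ∨ ε = -1) ∧ ∀ b : F, b ≠ 0 →
      (Fintype.card K : ℤ) * ∑ y : F, (if Algebra.trace K F (b * y) = 0 then quadraticChar F y else 0)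
        = ε * quadraticChar F b * (Fintype.card K - 1) * Q := by
  have hK : ringChar ℂ ≠ ringChar K := by
    have : ringChar K ≠ 0 := CharP.char_ne_zero_of_finite K _
    rw [ringChar.eq_zero]; exact this.symm
  obtain ⟨ψ, hψ⟩ : ∃ ψ : AddChar K ℂ, ψ.IsPrimitive := by
    have hp := AddChar.FiniteField.primitiveChar_to_Complex_isPrimitive K
    exact ⟨_, hp⟩
  let φ : AddChar F ℂ := ψ.compAddMonoidHom (Algebra.trace K F).toAddMonoidHom
  have hφa : ∀ x, φ x = ψ (Algebra.trace K F x) := fun x => rfl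
  have hφ : φ.IsPrimitive := by
    apply AddChar.IsPrimitive.of_ne_one
    intro h
    have h1 := hψ (a := 1) one_ne_zero
    apply h1
    ext k
    obtain ⟨x, hx⟩ := Algebra.trace_surjective K F k
    have := DFunLike.congr_fun h x
    rw [hφa, hx] at this
    simpa using this
  let χ : MulChar F ℂ := (quadraticChar F).ringHomComp (Int.castRingHom ℂ)
  have hχa : ∀ x, χ x = ((quadraticChar F x : ℤ) : ℂ) := fun x => rfl
  have hχ1 : χ ≠ 1 := by
    intro h
    apply quadraticChar_ne_one h2
    ext u
    have := DFunLike.congr_fun h (u : F)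
    rw [hχa] at this
    simp at this
    simpa using this
  have hχq : χ.IsQuadratic := (quadraticChar_isQuadratic F).comp _
  have hG := gaussSum_sq hχ1 hχq hφ
  have hm : χ (-1) = 1 := by
    have := hc (-1) (by simp)
    rw [hχa]
    simp only [map_neg, map_one] at this
    simp [this]
  rw [hm, hQ] at hG
  have hG' : gaussSum χ φ = Q ∨ gaussSum χ φ = -Q := by
    apply sq_eq_sq_iff_eq_or_eq_neg.mp
    rw [hG]; push_cast; ring
  obtain ⟨ε, hε, hGε⟩ : ∃ ε : ℤ, (ε = 1 ∨ ε = -1) ∧ gaussSum χ φ = ε * Q := by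
    rcases hG' with h | h
    · exact ⟨1, Or.inl rfl, by simp [h]⟩
    · exact ⟨-1, Or.inr rfl, by simp [h]⟩
  have hu : ∀ u : F, u ≠ 0 → ∑ y, χ y * φ (u * y) = χ u * gaussSum χ φ := by
    intro u hu0
    have h := gaussSum_mulShift χ φ (Units.mk0 u hu0)
    have hs : χ u * χ u = 1 := by
      rw [hχa]
      have := quadraticChar_sq_one (F := F) hu0
      rw [sq] at this
      exact_mod_cast this
    rw [← h, Units.val_mk0, ← mul_assoc, hs, one_mul]
    rfl
  refine ⟨ε, hε, fun b hb => ?_⟩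
  have hsum0 : ∑ y, χ y = 0 := by
    simp only [hχa]
    exact_mod_cast quadraticChar_sum_zero h2
  have hin : ∀ c : K, ∑ y, χ y * ψ (c * Algebra.trace K F (b * y)) =
      if c = 0 then 0 else χ b * gaussSum χ φ := by
    intro c
    split_ifs with h0
    · simp [h0, hsum0]
    · have h := hu (algebraMap K F c * b) (mul_ne_zero (by simpa using h0) hb)
      rw [map_mul, hχa (algebraMap K F c), hc c h0, Int.cast_one, one_mul] at h
      rw [← h]
      refine Finset.sum_congr rfl fun y _ => ?_
      rw [hφa, mul_assoc, ← Algebra.smul_def, map_smul, smul_eq_mul]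
  have hdouble : ∑ c : K, ∑ y, χ y * ψ (c * Algebra.trace K F (b * y)) =
      (Fintype.card K : ℂ) * ∑ y : F, (if Algebra.trace K F (b * y) = 0 then χ y else 0) := by
    rw [Finset.sum_comm, Finset.mul_sum]
    refine Finset.sum_congr rfl fun y _ => ?_
    rw [← Finset.mul_sum, AddChar.sum_mulShift _ hψ]
    split_ifs <;> simp [mul_comm]
  simp only [hin] at hdouble
  rw [Finset.sum_ite] at hdouble
  simp only [Finset.sum_const_zero, zero_add, Finset.sum_const, nsmul_eq_mul] at hdouble
  have hcard : ((Finset.univ.filter fun c : K => ¬ c = 0).card : ℂ) = Fintype.card K - 1 := by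
    rw [Finset.filter_ne' Finset.univ (0:K), Finset.card_erase_of_mem (Finset.mem_univ _), Finset.card_univ, Nat.cast_sub Fintype.card_pos]
    simp
  rw [hcard, hGε, hχa] at hdouble
  have : (((Fintype.card K : ℤ) * ∑ y : F, (if Algebra.trace K F (b * y) = 0 then quadraticChar F y else 0) : ℤ) : ℂ)
      = ((ε * quadraticChar F b * (Fintype.card K - 1) * Q : ℤ) : ℂ) := by
    push_cast
    simp only [hχa] at hdouble
    rw [← hdouble]; ring
  exact_mod_cast this

/-- number of x with Tr(b x^2) ≠ 0 -/
theorem aux_T (K F : Type*) [Field K] [Fintype K] [DecidableEq K] [Field F] [Fintype F] [Algebra K F]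
    (Q : ℕ) (hQ : Fintype.card F = Q ^ 2) (h2 : ringChar F ≠ 2)
    (hc : ∀ c : K, c ≠ 0 → quadraticChar F (algebraMap K F c) = 1) :
    ∃ ε : ℤ, (ε = 1 ∨ ε = -1) ∧ ∀ b : F, b ≠ 0 →
      (Fintype.card K : ℤ) * (Finset.univ.filter fun x : F => Algebra.trace K F (b * x ^ 2) ≠ 0).card
        = (Fintype.card K - 1) * Q * (Q - ε * quadraticChar F b) := by
  obtain ⟨ε, hε, h⟩ := aux_gauss K F Q hQ h2 hc
  refine ⟨ε, hε, fun b hb => ?_⟩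
  have h1 := h b hb
  have h3 := aux_fiber K F b hb 0
  have h4 := Finset.card_filter_add_card_filter_not (s := (Finset.univ : Finset F))
    (fun x : F => Algebra.trace K F (b * x ^ 2) = 0)
  have h5 : ((Finset.univ.filter fun x : F => Algebra.trace K F (b * x ^ 2) = 0).card : ℤ)
      = ∑ y : F, (if Algebra.trace K F (b * y) = 0 then quadraticChar F y else 0)
        + (Finset.univ.filter fun x : F => Algebra.trace K F (b * x) = 0).card := by
    have := Finset.card_eq_sum_card_fiberwise (f := fun x : F => x ^ 2)
      (s := Finset.univ.filter fun x : F => Algebra.trace K F (b * x ^ 2) = 0)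
      (t := Finset.univ.filter fun x : F => Algebra.trace K F (b * x) = 0) (by intro x; simp)
    rw [this, Finset.card_eq_sum_ones, ← Finset.sum_filter]
    push_cast
    rw [← Finset.sum_add_distrib]
    refine Finset.sum_congr rfl fun y hy => ?_
    rw [← quadraticChar_card_sqrts h2]
    congr 2
    ext x
    simp only [Finset.mem_filter, Finset.mem_univ, true_and] at hy
    simp only [Finset.mem_filter, Finset.mem_univ, true_and, Set.mem_toFinset, Set.mem_ofPred_eq]
    constructor
    · exact fun h => h.2
    · intro h; exact ⟨by rw [h]; exact hy, h⟩
  rw [Finset.card_univ, hQ] at h4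
  rw [hQ] at h3
  zify at h3 h4
  linear_combination (Fintype.card K : ℤ) * h4 - (Fintype.card K : ℤ) * h5 - h1 - h3

theorem aux_count (p : ℕ → Prop) [DecidablePred p] (N : ℕ) (hp : ∀ i, p (N + i) ↔ p i) (k : ℕ) :
    Nat.count p (k * N) = k * Nat.count p N := by
  induction k with
  | zero => simp
  | succ k ih =>
    have : Nat.count p (N + k * N) = Nat.count p N + Nat.count p (k * N) := by
      rw [Nat.count_add]; simp only [hp]
    rw [add_mul, one_mul, add_comm, this, ih]; ring

theorem aux_omega_ne (F : Type*) [Field F] [Fintype F] (hF : 3 ≤ Fintype.card F) (ω : F)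
    (hω : ∀ x : F, x ≠ 0 → ∃ k : ℕ, x = ω ^ k) : ω ≠ 0 := by
  rintro rfl
  have hsub : (Finset.univ : Finset F) ⊆ {0, 1} := by
    intro x _
    by_cases hx : x = 0
    · simp [hx]
    · obtain ⟨k, hk⟩ := hω x hx
      rcases Nat.eq_zero_or_pos k with rfl | hk0
      · simp [hk]
      · rw [zero_pow hk0.ne'] at hk; simp [hk]
  have := Finset.card_le_card hsub
  rw [Finset.card_univ] at this
  have h2 := Finset.card_le_two (a := (0:F)) (b := 1)
  omega

theorem aux_omega (F : Type*) [Field F] [Fintype F] (hF : 3 ≤ Fintype.card F) (ω : F)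
    (hω : ∀ x : F, x ≠ 0 → ∃ k : ℕ, x = ω ^ k) (P : F → Prop) [DecidablePred P] (hP : ¬ P 0) :
    (Finset.univ.filter fun x : F => P x).card
      = Nat.count (fun i => P (ω ^ i)) (Fintype.card F - 1) := by
  have hω0 : ω ≠ 0 := aux_omega_ne F hF ω hω
  have hpow : ω ^ (Fintype.card F - 1) = 1 := FiniteField.pow_card_sub_one_eq_one ω hω0
  have him : (Finset.range (Fintype.card F - 1)).image (fun i => ω ^ i)
      = Finset.univ.erase (0 : F) := by
    ext x
    simp only [Finset.mem_image, Finset.mem_range, Finset.mem_erase, Finset.mem_univ, and_true]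
    constructor
    · rintro ⟨i, _, rfl⟩; exact pow_ne_zero _ hω0
    · intro hx
      obtain ⟨k, hk⟩ := hω x hx
      refine ⟨k % (Fintype.card F - 1), Nat.mod_lt _ (by omega), ?_⟩
      rw [hk, ← pow_eq_pow_mod _ hpow]
  have hinj : Set.InjOn (fun i => ω ^ i) (Finset.range (Fintype.card F - 1) : Set ℕ) := by
    rw [← Finset.card_image_iff, him]
    simp [Finset.card_erase_of_mem]
  rw [Nat.count_eq_card_filter_range]
  have h1 : (Finset.univ.filter fun x : F => P x) = ((Finset.range (Fintype.card F - 1)).image (fun i => ω ^ i)).filter P := by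
    rw [him]
    ext x
    simp only [Finset.mem_filter, Finset.mem_erase, Finset.mem_univ, and_true, true_and]
    constructor
    · intro h; exact ⟨by rintro rfl; exact hP h, h⟩
    · exact fun h => h.2
  rw [h1, Finset.filter_image, Finset.card_image_of_injOn]
  exact hinj.mono (by intro x; simp; tauto)

theorem aux_qc (F : Type*) [Field F] [Fintype F] (h2 : ringChar F ≠ 2) (s : ℤ)
    (hs : s = 1 ∨ s = -1) :
    (Finset.univ.filter fun b : F => b ≠ 0 ∧ quadraticChar F b = s).card
      = (Fintype.card F - 1) / 2 := by
  have e1 : ∀ b : F, (if b ≠ 0 ∧ quadraticChar F b = 1 then (1:ℤ) else 0)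
      - (if b ≠ 0 ∧ quadraticChar F b = -1 then 1 else 0) = quadraticChar F b := by
    intro b
    by_cases hb : b = 0
    · simp [hb]
    · rcases quadraticChar_dichotomy hb with h | h <;> simp [hb, h]
  have e2 : ∀ b : F, (if b ≠ 0 ∧ quadraticChar F b = 1 then (1:ℤ) else 0)
      + (if b ≠ 0 ∧ quadraticChar F b = -1 then 1 else 0) = if b ≠ 0 then 1 else 0 := by
    intro b
    by_cases hb : b = 0
    · simp [hb]
    · rcases quadraticChar_dichotomy hb with h | h <;> simp [hb, h]
  have s1 := Finset.sum_congr (rfl : (Finset.univ : Finset F) = _) (fun b _ => e1 b)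
  have s2 := Finset.sum_congr (rfl : (Finset.univ : Finset F) = _) (fun b _ => e2 b)
  rw [quadraticChar_sum_zero h2, Finset.sum_sub_distrib] at s1
  rw [Finset.sum_add_distrib] at s2
  simp only [Finset.sum_boole] at s1 s2
  rw [Finset.filter_ne' Finset.univ (0:F), Finset.card_erase_of_mem (Finset.mem_univ _),
    Finset.card_univ] at s2
  rcases hs with rfl | rfl <;> omega

theorem aux_wA (q m1 n : ℕ) (Kq E1 E : Type*)
    [Field Kq] [Fintype Kq] [DecidableEq Kq]
    [Field E1] [Fintype E1] [Field E] [Fintype E]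
    [Algebra Kq E1] [Algebra Kq E] [Algebra E1 E]
    (hq : q = Fintype.card Kq) (hm1 : 1 ≤ m1) (hc1 : Fintype.card E1 = q ^ m1) (ω : E)
    (a : E1) (b : E) (ha : a ≠ 0) :
    hammingNorm (cword Kq E1 E ω 2 n a b) = 2 * n * q ^ (m1 - 1) * (q - 1) := by
  have hq0 : 0 < q := by rw [hq]; exact Fintype.card_pos
  have key : ∀ c : Kq, (∑ x : E1, if Algebra.trace Kq E1 (a * x) + c ≠ 0 then 1 else 0)
      = q ^ (m1 - 1) * (q - 1) := by
    intro c
    have h := aux_fiber_ne Kq E1 a ha c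
    rw [← hq, hc1, Finset.card_filter] at h
    apply Nat.eq_of_mul_eq_mul_right hq0
    have e : q ^ m1 = q ^ (m1 - 1) * q := by rw [← pow_succ]; congr 1; omega
    rw [e] at h
    have h' : (∑ x : E1, if Algebra.trace Kq E1 (a * x) + c ≠ 0 then 1 else 0) * q =
       q ^ (m1 - 1) * q * (q - 1) := by rw [← h]
    rw [h']; ring
  unfold hammingNorm
  rw [Finset.card_filter, Fintype.sum_prod_type]
  simp only [Fintype.sum_prod_type, Fintype.sum_bool, cword, if_true, Bool.false_eq_true, if_false]
  rw [Finset.sum_comm]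
  simp only [Finset.sum_add_distrib, key]
  simp
  ring

theorem aux_wB (n : ℕ) (Kq E1 E : Type*)
    [Field Kq] [Fintype Kq] [DecidableEq Kq]
    [Field E1] [Fintype E1] [Field E] [Fintype E]
    [Algebra Kq E1] [Algebra Kq E] [Algebra E1 E] (ω : E) (b : E) :
    hammingNorm (cword Kq E1 E ω 2 n 0 b) = 2 * Fintype.card E1 *
      Nat.count (fun i => Algebra.trace Kq E (b * (ω ^ i) ^ 2) ≠ 0) n := by
  unfold hammingNorm
  rw [Finset.card_filter, Fintype.sum_prod_type]
  simp only [Fintype.sum_prod_type, Fintype.sum_bool, cword, if_true, Bool.false_eq_true, if_false,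
    zero_mul, map_zero, zero_add]
  rw [Nat.count_eq_card_filter_range, Finset.card_filter, ← Fin.sum_univ_eq_sum_range
    (fun i => if Algebra.trace Kq E (b * (ω ^ i) ^ 2) ≠ 0 then 1 else 0)]
  simp only [Finset.sum_const, Finset.card_univ, smul_eq_mul, Finset.sum_add_distrib, ← pow_mul,
    mul_comm 2]
  ring_nf

set_option maxHeartbeats 2000000 in
/-- If `h = 2` (which forces `m` even), `C_K` is a three-weight linear code of length
`2nq^{m_1}`, dimension `m+m_1`, and minimum distance
`(2nq^{m/2+m_1−1}(q−1)/(q^m−1))(q^{m/2}−1)`, with weight `2nq^{m_1−1}(q−1)` of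
frequency `q^{m_1+m}−q^m`, and weights
`(2nq^{m/2+m_1−1}(q−1)/(q^m−1))(q^{m/2}∓1)` each of frequency `(q^m−1)/2`. -/
theorem stmt12 (q m m1 n : ℕ) (Kq E1 E : Type*)
    [Field Kq] [Fintype Kq] [DecidableEq Kq]
    [Field E1] [Fintype E1] [Field E] [Fintype E]
    [Algebra Kq E1] [Algebra Kq E] [Algebra E1 E] [IsScalarTower Kq E1 E]
    (hq : q = Fintype.card Kq) (hqodd : Odd q)
    (hm1 : m1 ∣ m) (hc1 : Fintype.card E1 = q ^ m1) (hc : Fintype.card E = q ^ m)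
    (ω : E) (hω : ∀ x : E, x ≠ 0 → ∃ k : ℕ, x = ω ^ k)
    (hh : 2 ∣ (q ^ m - 1) / (q - 1))
    (hn0 : 0 < n) (hn : (q ^ m - 1) / (2 * (q - 1)) ∣ n) :
    Even m ∧
    Fintype.card (E1 × Fin n × Bool) = 2 * n * q ^ m1 ∧
    Function.Injective (fun ab : E1 × E => cword Kq E1 E ω 2 n ab.1 ab.2) ∧
    (∀ a : E1, ∀ b : E, (a, b) ≠ (0, 0) →
      2 * n * (q : ℚ) ^ (m / 2 + m1 - 1) * ((q : ℚ) - 1) * ((q : ℚ) ^ (m / 2) - 1) /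
          ((q : ℚ) ^ m - 1) ≤
        (hammingNorm (cword Kq E1 E ω 2 n a b) : ℚ)) ∧
    (Finset.univ.filter fun ab : E1 × E =>
        hammingNorm (cword Kq E1 E ω 2 n ab.1 ab.2) =
          2 * n * q ^ (m1 - 1) * (q - 1)).card = q ^ (m1 + m) - q ^ m ∧
    (Finset.univ.filter fun ab : E1 × E =>
        (hammingNorm (cword Kq E1 E ω 2 n ab.1 ab.2) : ℚ) =
          2 * n * (q : ℚ) ^ (m / 2 + m1 - 1) * ((q : ℚ) - 1) * ((q : ℚ) ^ (m / 2) - 1) /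
            ((q : ℚ) ^ m - 1)).card = (q ^ m - 1) / 2 ∧
    (Finset.univ.filter fun ab : E1 × E =>
        (hammingNorm (cword Kq E1 E ω 2 n ab.1 ab.2) : ℚ) =
          2 * n * (q : ℚ) ^ (m / 2 + m1 - 1) * ((q : ℚ) - 1) * ((q : ℚ) ^ (m / 2) + 1) /
            ((q : ℚ) ^ m - 1)).card = (q ^ m - 1) / 2 := by
  have hqK : 1 < q := by rw [hq]; exact Fintype.one_lt_card
  have hq3 : 3 ≤ q := by obtain ⟨t, ht⟩ := hqodd; omega
  have hm1pos : 1 ≤ m1 := by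
    rcases Nat.eq_zero_or_pos m1 with h | h
    · have := Fintype.one_lt_card (α := E1); rw [hc1, h] at this; simp at this
    · exact h
  have hmpos : 1 ≤ m := by
    rcases Nat.eq_zero_or_pos m with h | h
    · have := Fintype.one_lt_card (α := E); rw [hc, h] at this; simp at this
    · exact h
  have hgs := Nat.geomSum_eq (m := q) (by omega) m
  have hdvd : q - 1 ∣ q ^ m - 1 := by simpa using Nat.sub_dvd_pow_sub_pow q 1 m
  have heven : Even m := by
    by_contra hodd
    have : Odd (∑ k ∈ Finset.range m, q ^ k) := by
      rw [Finset.odd_sum_iff_odd_card_odd, Finset.filter_true_of_mem (fun i _ => hqodd.pow)]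
      simpa using hodd
    rw [hgs] at this
    obtain ⟨t, ht⟩ := this
    omega
  obtain ⟨N, hN⟩ := hh
  have hS : q ^ m - 1 = (q - 1) * (2 * N) := by rw [← hN, Nat.mul_div_cancel' hdvd]
  have hNd : (q ^ m - 1) / (2 * (q - 1)) = N := by
    rw [hS, show (q - 1) * (2 * N) = (2 * (q - 1)) * N by ring,
      Nat.mul_div_cancel_left _ (by omega)]
  rw [hNd] at hn
  obtain ⟨k, hk⟩ := hn
  obtain ⟨r, hr⟩ := heven
  have hr1 : 1 ≤ r := by omega
  have hm2 : m / 2 = r := by omega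
  have hmr : q ^ m = (q ^ r) ^ 2 := by rw [← pow_mul]; congr 1; omega
  have hqm : q ≤ q ^ m := Nat.le_self_pow (by omega) q
  have hqr : q ≤ q ^ r := Nat.le_self_pow (by omega) q
  have hF : 3 ≤ Fintype.card E := by rw [hc]; omega
  have hchar : ringChar E ≠ 2 := by
    intro h
    have := FiniteField.even_card_of_char_two h
    rw [hc] at this
    have h1 : Odd (q ^ m) := hqodd.pow
    rw [Nat.odd_iff] at h1
    omega
  have hω0 := aux_omega_ne E hF ω hω
  have hsq : ∀ c : Kq, c ≠ 0 → quadraticChar E (algebraMap Kq E c) = 1 := by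
    intro c hc0
    rw [quadraticChar_eq_pow_of_char_ne_two hchar (by simpa using hc0), if_pos]
    have e : Fintype.card E / 2 = (q - 1) * N := by
      have : q ^ m - 1 = 2 * ((q - 1) * N) := by rw [hS]; ring
      rw [hc]
      have h1 : Odd (q ^ m) := hqodd.pow
      rw [Nat.odd_iff] at h1
      omega
    rw [e, ← map_pow, pow_mul, hq, FiniteField.pow_card_sub_one_eq_one c hc0]
    simp
  obtain ⟨ε, hε, hT⟩ := aux_T Kq E (q ^ r) (by rw [hc, hmr]) hchar hsq
  have hper : ∀ b : E, ∀ i, Algebra.trace Kq E (b * (ω ^ (N + i)) ^ 2) ≠ 0 ↔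
      Algebra.trace Kq E (b * (ω ^ i) ^ 2) ≠ 0 := by
    intro b i
    have hu := FiniteField.algebraMap_norm_eq_pow (K := Kq) (x := ω)
    rw [Nat.card_eq_fintype_card, Nat.card_eq_fintype_card, hc, ← hq, hN] at hu
    have hu0 : Algebra.norm Kq ω ≠ 0 := Algebra.norm_ne_zero_iff.mpr hω0
    have : b * (ω ^ (N + i)) ^ 2 = Algebra.norm Kq ω • (b * (ω ^ i) ^ 2) := by
      rw [Algebra.smul_def, hu]; ring
    rw [this, map_smul, smul_eq_mul]
    simp [hu0]
  have hqmQ : (0:ℚ) < (q:ℚ) ^ m - 1 := by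
    have : (3:ℚ) ≤ (q:ℚ) ^ m := by exact_mod_cast (by omega : 3 ≤ q ^ m)
    linarith
  have wA : ∀ a : E1, ∀ b : E, a ≠ 0 → hammingNorm (cword Kq E1 E ω 2 n a b) =
      2 * n * q ^ (m1 - 1) * (q - 1) := fun a b ha =>
    aux_wA q m1 n Kq E1 E hq hm1pos hc1 ω a b ha
  have w0 : hammingNorm (cword Kq E1 E ω 2 n 0 0) = 0 := by
    rw [aux_wB]; simp [Nat.count_eq_card_filter_range]
  have wB : ∀ b : E, b ≠ 0 → (hammingNorm (cword Kq E1 E ω 2 n 0 b) : ℚ) =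
      2 * n * (q : ℚ) ^ (r + m1 - 1) * ((q : ℚ) - 1) * ((q : ℚ) ^ r - ε * quadraticChar E b) /
            ((q : ℚ) ^ m - 1) := by
    intro b hb
    rw [aux_wB, hc1]
    have c1 := aux_count (fun i => Algebra.trace Kq E (b * (ω ^ i) ^ 2) ≠ 0) N (hper b) k
    rw [mul_comm, ← hk] at c1
    have c2 := aux_count (fun i => Algebra.trace Kq E (b * (ω ^ i) ^ 2) ≠ 0) N (hper b) ((q - 1) * 2)
    rw [mul_assoc, ← hS, ← hc, ← aux_omega E hF ω hω
      (fun x => Algebra.trace Kq E (b * x ^ 2) ≠ 0) (by simp)] at c2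
    have c3 := hT b hb
    rw [c2, ← hq] at c3
    rw [c1]
    generalize Nat.count (fun i => Algebra.trace Kq E (b * (ω ^ i) ^ 2) ≠ 0) N = Z at c3 ⊢
    have hS' : (q:ℚ) ^ m - 1 = (q - 1) * (2 * N) := by
      have : ((q ^ m - 1 : ℕ) : ℚ) = (((q - 1) * (2 * N) : ℕ) : ℚ) := by rw [hS]
      rw [Nat.cast_sub (by omega)] at this
      push_cast [Nat.cast_sub (show 1 ≤ q by omega)] at this
      exact this
    have c4 : (q:ℚ) * (((q:ℚ) - 1) * 2 * Z) = (q - 1) * q ^ r * (q ^ r - ε * quadraticChar E b) := by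
      have : (((q:ℤ) * (((q - 1) * 2 * Z : ℕ) : ℤ) : ℤ) : ℚ) = _ := congrArg _ c3
      push_cast [Nat.cast_sub (show 1 ≤ q by omega)] at this
      exact this
    have hq1 : (q:ℚ) - 1 ≠ 0 := by
      have : (3:ℚ) ≤ q := by exact_mod_cast hq3
      intro h; linarith
    have hq0 : (q:ℚ) ≠ 0 := by positivity
    have e1 : (q:ℚ) ^ (r + m1 - 1) * q = q ^ r * q ^ m1 := by
      rw [← pow_succ, ← pow_add]; congr 1; omega
    rw [eq_div_iff hqmQ.ne', hS', hk]
    apply mul_right_cancel₀ hq0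
    push_cast
    linear_combination (2 * (q:ℚ) ^ m1 * k * N) * c4 - 2 * N * k * (q - 1) * (q ^ r - ε * quadraticChar E b) * e1
  rw [hm2]
  have hn0Q : (0:ℚ) < n := by exact_mod_cast hn0
  have hq3Q : (3:ℚ) ≤ q := by exact_mod_cast hq3
  have hqrQ : (3:ℚ) ≤ (q:ℚ) ^ r := by exact_mod_cast (by omega : 3 ≤ q ^ r)
  have hmrQ : (q:ℚ) ^ m = (q ^ r) ^ 2 := by exact_mod_cast hmr
  set A : ℕ := 2 * n * q ^ (m1 - 1) * (q - 1) with hA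
  set B1 : ℚ := 2 * n * (q : ℚ) ^ (r + m1 - 1) * ((q : ℚ) - 1) * ((q : ℚ) ^ r - 1) /
            ((q : ℚ) ^ m - 1) with hB1
  set B2 : ℚ := 2 * n * (q : ℚ) ^ (r + m1 - 1) * ((q : ℚ) - 1) * ((q : ℚ) ^ r + 1) /
            ((q : ℚ) ^ m - 1) with hB2
  have hAQ : (A:ℚ) = 2 * n * (q:ℚ) ^ (m1 - 1) * (q - 1) := by
    rw [hA]; push_cast [Nat.cast_sub (show 1 ≤ q by omega)]; ring
  have e2 : (q:ℚ) ^ (r + m1 - 1) = q ^ r * q ^ (m1 - 1) := by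
    rw [← pow_add]; congr 1; omega
  have hApos : (0:ℚ) < A := by
    rw [hAQ]; have : (0:ℚ) < q - 1 := by linarith
    positivity
  have hB1A : B1 * (q ^ r + 1) = A * q ^ r := by
    rw [hB1, hAQ, e2, hmrQ]
    have : ((q:ℚ) ^ r) ^ 2 - 1 ≠ 0 := by rw [← hmrQ]; exact hqmQ.ne'
    field_simp
    ring
  have hB2A : B2 * (q ^ r - 1) = A * q ^ r := by
    rw [hB2, hAQ, e2, hmrQ]
    have : ((q:ℚ) ^ r) ^ 2 - 1 ≠ 0 := by rw [← hmrQ]; exact hqmQ.ne'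
    field_simp
    ring
  have hB1pos : 0 < B1 := by
    by_contra h
    push Not at h
    nlinarith
  have hB1ltA : B1 < A := by
    by_contra h
    push Not at h
    nlinarith
  have hAltB2 : A < B2 := by
    by_contra h
    push Not at h
    nlinarith
  have wB1 : ∀ b : E, b ≠ 0 → quadraticChar E b = ε →
      (hammingNorm (cword Kq E1 E ω 2 n 0 b) : ℚ) = B1 := by
    intro b hb h
    rw [wB b hb, h, hB1]
    rcases hε with h | h <;> rw [h] <;> norm_num
  have wB2 : ∀ b : E, b ≠ 0 → quadraticChar E b = -ε →
      (hammingNorm (cword Kq E1 E ω 2 n 0 b) : ℚ) = B2 := by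
    intro b hb h
    rw [wB b hb, h, hB2]
    rcases hε with h | h <;> rw [h] <;> norm_num
  have hdich : ∀ b : E, b ≠ 0 → quadraticChar E b = ε ∨ quadraticChar E b = -ε := by
    intro b hb
    have := quadraticChar_dichotomy hb
    rcases hε with h | h <;> rw [h] <;> simp <;> tauto
  have hεne : ε ≠ -ε := by rcases hε with h | h <;> rw [h] <;> norm_num
  have wAQ : ∀ a : E1, ∀ b : E, a ≠ 0 → (hammingNorm (cword Kq E1 E ω 2 n a b) : ℚ) = A :=
    fun a b ha => by rw [wA a b ha]
  have w0Q : (hammingNorm (cword Kq E1 E ω 2 n 0 0) : ℚ) = 0 := by rw [w0]; simp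
  have hmin : ∀ a : E1, ∀ b : E, (a, b) ≠ (0, 0) →
      B1 ≤ (hammingNorm (cword Kq E1 E ω 2 n a b) : ℚ) := by
    intro a b hab
    by_cases ha : a = 0
    · subst ha
      have hb : b ≠ 0 := by rintro rfl; exact hab rfl
      rcases hdich b hb with h | h
      · rw [wB1 b hb h]
      · rw [wB2 b hb h]; linarith
    · rw [wAQ a b ha]; linarith
  have hsub : ∀ a a' : E1, ∀ b b' : E, cword Kq E1 E ω 2 n (a - a') (b - b') =
      cword Kq E1 E ω 2 n a b - cword Kq E1 E ω 2 n a' b' := by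
    intro a a' b b'
    funext z
    simp only [cword, Pi.sub_apply]
    split_ifs
    · simp only [sub_mul, map_sub]; ring
    · simp only [sub_mul, add_mul, map_sub, map_add]; ring
  have hcount : ∀ s : ℤ, (s = 1 ∨ s = -1) → (Finset.univ.filter fun ab : E1 × E =>
      ab.1 = 0 ∧ ab.2 ≠ 0 ∧ quadraticChar E ab.2 = s).card = (q ^ m - 1) / 2 := by
    intro s hs
    rw [← hc, ← aux_qc E hchar s hs]
    symm
    apply Finset.card_bij (fun b _ => ((0 : E1), b))
    · intro b hb; simpa using hb
    · intro b _ b' _ h; simpa using h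
    · rintro ⟨a, b⟩ h
      simp only [Finset.mem_filter, Finset.mem_univ, true_and] at h
      obtain ⟨h1, h2⟩ := h
      exact ⟨b, by simpa using h2, by rw [h1]⟩
  refine ⟨⟨r, hr⟩, ?_, ?_, hmin, ?_, ?_, ?_⟩
  · simp [hc1]; ring
  · rintro ⟨a, b⟩ ⟨a', b'⟩ h
    by_contra hne
    have h1 := hmin (a - a') (b - b') (by
      intro h; apply hne
      simp only [Prod.mk.injEq, sub_eq_zero] at h
      simp [h.1, h.2])
    have h' : cword Kq E1 E ω 2 n a b = cword Kq E1 E ω 2 n a' b' := h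
    rw [hsub, h', sub_self, hammingNorm_zero] at h1
    simp at h1
    linarith
  · have : (Finset.univ.filter fun ab : E1 × E =>
        hammingNorm (cword Kq E1 E ω 2 n ab.1 ab.2) = A) =
        (Finset.univ.erase (0 : E1)) ×ˢ (Finset.univ : Finset E) := by
      ext ⟨a, b⟩
      simp only [Finset.mem_filter, Finset.mem_univ, true_and, Finset.mem_product,
        Finset.mem_erase, and_true]
      constructor
      · rintro h rfl
        have h' : (hammingNorm (cword Kq E1 E ω 2 n 0 b) : ℚ) = A := by rw [h]
        by_cases hb : b = 0
        · subst hb; linarith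
        · rcases hdich b hb with h2 | h2
          · linarith [wB1 b hb h2]
          · linarith [wB2 b hb h2]
      · exact wA a b
    rw [this, Finset.card_product, Finset.card_erase_of_mem (Finset.mem_univ _), Finset.card_univ,
      Finset.card_univ, hc, hc1, Nat.sub_mul, one_mul, pow_add]
  · rw [← hcount ε hε]
    congr 1
    ext ⟨a, b⟩
    simp only [Finset.mem_filter, Finset.mem_univ, true_and]
    constructor
    · intro h
      by_cases ha : a = 0
      · subst ha
        by_cases hb : b = 0
        · subst hb; linarith
        · refine ⟨rfl, hb, ?_⟩
          rcases hdich b hb with h2 | h2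
          · exact h2
          · linarith [wB2 b hb h2]
      · linarith [wAQ a b ha]
    · rintro ⟨rfl, hb, h⟩
      exact wB1 b hb h
  · rw [← hcount (-ε) (by rcases hε with h | h <;> rw [h] <;> simp)]
    congr 1
    ext ⟨a, b⟩
    simp only [Finset.mem_filter, Finset.mem_univ, true_and]
    constructor
    · intro h
      by_cases ha : a = 0
      · subst ha
        by_cases hb : b = 0
        · subst hb; linarith
        · refine ⟨rfl, hb, ?_⟩
          rcases hdich b hb with h2 | h2
          · linarith [wB1 b hb h2]
          · exact h2
      · linarith [wAQ a b ha]
    · rintro ⟨rfl, hb, h⟩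
      exact wB2 b hb h
end

section
/- In the semiprimitive case with q^m = p^{2jγ}, h | (p^j+1), j minimal, and 2 ≤ h < q^{m/2}+1, the code C_K is a three-weight [2nq^{m_1}, m+m_1] code whose nonzero weights are: 2nq^{m_1−1}(q−1) with frequency q^{m_1+m}−q^m; (2nq^{m/2+m_1−1}(q−1)/(q^m−1))(q^{m/2}+(−1)^γ(h−1)) with frequency (q^m−1)/h; and (2nq^{m/2+m_1−1}(q−1)/(q^m−1))(q^{m/2}+(−1)^{γ+1}) with frequency (q^m−1)(h−1)/h. -/
open scoped Classical

lemma conv_dvd_one {G : Type*} [CommGroup G] [Fintype G] (p : ℕ) [Fact p.Prime]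
    (hG : (Fintype.card G).Coprime p) (f : G → ℤ)
    (H : ∀ c, (p : ℤ) ∣ ∑ b, f b * f (b⁻¹ * c)) (b₀ : G) : (p : ℤ) ∣ f b₀ := by
  have hp := (Fact.out : p.Prime)
  have : CharP (MonoidAlgebra (ZMod p) G) p :=
    charP_of_injective_algebraMap (algebraMap (ZMod p) (MonoidAlgebra (ZMod p) G)).injective p
  let F : MonoidAlgebra (ZMod p) G := ∑ b, MonoidAlgebra.single b (f b : ZMod p)
  have hF2 : F * F = 0 := by
    have h1 : F * F = ∑ b, ∑ d, MonoidAlgebra.single (b * d) ((f b : ZMod p) * (f d : ZMod p)) := by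
      simp only [F, Finset.sum_mul_sum, MonoidAlgebra.single_mul_single]
    have h2 : F * F = ∑ b, ∑ c, MonoidAlgebra.single c ((f b : ZMod p) * (f (b⁻¹ * c) : ZMod p)) := by
      rw [h1]
      refine Finset.sum_congr rfl fun b _ => ?_
      refine Fintype.sum_equiv (Equiv.mulLeft b) _ _ fun d => ?_
      simp
    rw [h2, Finset.sum_comm]
    refine Finset.sum_eq_zero fun c _ => ?_
    have h3 : ∑ b, MonoidAlgebra.single c ((f b : ZMod p) * (f (b⁻¹ * c) : ZMod p))
        = MonoidAlgebra.single c (∑ b, (f b : ZMod p) * (f (b⁻¹ * c) : ZMod p)) := by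
      exact (map_sum (MonoidAlgebra.singleAddHom c) _ _).symm
    rw [h3]
    have h4 : (∑ b, (f b : ZMod p) * (f (b⁻¹ * c) : ZMod p)) = 0 := by
      have := (ZMod.intCast_zmod_eq_zero_iff_dvd _ p).2 (H c)
      push_cast at this
      exact this
    rw [h4]; simp
  have hFp : F ^ p = 0 := by
    have : F ^ p = F * F * F ^ (p - 2) := by
      rw [← pow_two, ← pow_add]; congr 1; have := hp.two_le; omega
    rw [this, hF2, zero_mul]
  rw [sum_pow_char p] at hFp
  simp only [MonoidAlgebra.single_pow] at hFp
  have hinj : ∀ b c : G, b ^ p = c ^ p → b = c := by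
    intro b c hbc
    have hc : (Nat.card G).Coprime p := by rwa [Nat.card_eq_fintype_card]
    exact (powCoprime hc).injective hbc
  have := DFunLike.congr_fun (congrArg MonoidAlgebra.coeff hFp) (b₀ ^ p)
  rw [MonoidAlgebra.coeff_sum, Finsupp.finsetSum_apply, Finset.sum_eq_single b₀] at this
  · simp at this
    exact (ZMod.intCast_zmod_eq_zero_iff_dvd _ p).1 this
  · intro b _ hb
    rw [MonoidAlgebra.coeff_single, Finsupp.single_apply, if_neg]
    exact fun h => hb (hinj _ _ h)
  · simp

lemma conv_dvd {G : Type*} [CommGroup G] [Fintype G] (p : ℕ) [Fact p.Prime]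
    (hG : (Fintype.card G).Coprime p) (N : ℕ) : ∀ (f : G → ℤ)
    (_ : ∀ c, (p : ℤ) ^ (2 * N) ∣ ∑ b, f b * f (b⁻¹ * c)) (b₀ : G), (p : ℤ) ^ N ∣ f b₀ := by
  have hp := (Fact.out : p.Prime)
  induction N with
  | zero => simp
  | succ N ih =>
    intro f H b₀
    have h1 := conv_dvd_one p hG f fun c => dvd_trans (dvd_pow_self _ (by omega)) (H c)
    choose g hg using h1
    have := ih g (fun c => by
      have h2 := H c
      have h3 : ∑ b, f b * f (b⁻¹ * c) = (p : ℤ) ^ 2 * ∑ b, g b * g (b⁻¹ * c) := by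
        rw [Finset.mul_sum]
        refine Finset.sum_congr rfl fun b _ => ?_
        rw [hg, hg (b⁻¹ * c)]; ring
      rw [h3, show 2 * (N + 1) = 2 + 2 * N by ring, pow_add] at h2
      exact Int.dvd_of_mul_dvd_mul_left (by have := hp.pos; positivity) h2) b₀
    rw [hg, pow_succ']
    exact mul_dvd_mul_left _ this

/-- final integer argument -/
lemma two_valued {G : Type*} [Fintype G] (f : G → ℤ) (s h ε C : ℤ) (hh : 2 ≤ h) (hs : 2 ≤ s)
    (hε : ε * ε = 1) (hsε : h ∣ s - ε) (hdvd : ∀ b, s ∣ f b) (hmod : ∀ b, h ∣ f b - 1)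
    (hcard : (Fintype.card G : ℤ) = h * C) (h1 : ∑ b, f b = 0)
    (h2 : ∑ b, f b * f b = C * h * (s * s) * (h - 1)) :
    ∃ u : G → ℤ, (∀ b, u b = 0 ∨ u b = 1) ∧ (∀ b, f b = s * ε * (1 - h * u b)) ∧
      ∑ b, u b = C := by
  choose t ht using hdvd
  have hu : ∀ b, ∃ u, t b = ε * (1 - h * u) := by
    intro b
    obtain ⟨k, hk⟩ := hmod b
    obtain ⟨l, hl⟩ := hsε
    rw [ht] at hk
    -- s t = 1 + h k, s = ε + h l
    refine ⟨l * t b - k, ?_⟩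
    have : s = ε + h * l := by linarith
    rw [this] at hk
    have e1 : ε * t b = 1 - h * (l * t b - k) := by linarith
    calc t b = ε * ε * t b := by rw [hε]; ring
      _ = _ := by rw [mul_assoc, e1]
  choose u hu using hu
  have hf : ∀ b, f b = s * ε * (1 - h * u b) := fun b => by rw [ht, hu]; ring
  have hε0 : ε ≠ 0 := by rintro rfl; simp at hε
  have hS1 : ∑ b, u b = C := by
    simp only [hf] at h1
    rw [← Finset.mul_sum, Finset.sum_sub_distrib, ← Finset.mul_sum] at h1
    simp only [Finset.sum_const, Finset.card_univ, nsmul_eq_mul, mul_one, hcard] at h1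
    have : s * ε ≠ 0 := mul_ne_zero (by omega) hε0
    have h3 := (mul_eq_zero.1 h1).resolve_left this
    have h4 : h * (∑ b, u b - C) = 0 := by linarith
    have := (mul_eq_zero.1 h4).resolve_left (by omega)
    linarith
  have hS2 : ∑ b, u b * u b = C := by
    have : ∀ b, f b * f b = s * s * (1 - 2 * h * u b + h * h * (u b * u b)) := fun b => by
      rw [hf]
      calc _ = (ε * ε) * (s * s * (1 - 2 * h * u b + h * h * (u b * u b))) := by ring
        _ = _ := by rw [hε, one_mul]
    simp only [this] at h2
    rw [← Finset.mul_sum, Finset.sum_add_distrib, Finset.sum_sub_distrib, ← Finset.mul_sum,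
      ← Finset.mul_sum, hS1] at h2
    simp only [Finset.sum_const, Finset.card_univ, nsmul_eq_mul, mul_one, hcard] at h2
    have h3 : (s * s * (h * h)) * (∑ b, u b * u b - C) = 0 := by linarith
    have := (mul_eq_zero.1 h3).resolve_left (by positivity)
    linarith
  refine ⟨u, ?_, hf, hS1⟩
  have hz : ∑ b, (u b * u b - u b) = 0 := by rw [Finset.sum_sub_distrib, hS1, hS2]; ring
  have hnn : ∀ b ∈ Finset.univ, 0 ≤ u b * u b - u b := by
    intro b _
    rcases le_or_gt (u b) 0 with h0 | h0 <;> nlinarith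
  intro b
  have := (Finset.sum_eq_zero_iff_of_nonneg hnn).1 hz b (Finset.mem_univ _)
  have : u b * (u b - 1) = 0 := by linarith
  rcases mul_eq_zero.1 this with h0 | h0
  · exact Or.inl h0
  · right; linarith

noncomputable def nzc (K E : Type*) [Field K] [Field E] [Fintype E] [Algebra K E] (h : ℕ) (b : E) : ℕ :=
  (Finset.univ.filter fun x : E => Algebra.trace K E (b * x ^ h) ≠ 0).card

lemma nzc_mul_pow {K E : Type*} [Field K] [Field E] [Fintype E] [Algebra K E] (h : ℕ) (b y : E)
    (hy : y ≠ 0) : nzc K E h (b * y ^ h) = nzc K E h b := by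
  unfold nzc
  refine Finset.card_bij (fun x _ => y * x) ?_ ?_ ?_
  · intro x hx
    simpa [mul_pow, mul_assoc] using hx
  · intro x _ x' _ hxx
    exact mul_left_cancel₀ hy hxx
  · intro x hx
    refine ⟨y⁻¹ * x, ?_, by field_simp⟩
    simp only [Finset.mem_filter, Finset.mem_univ, true_and] at hx ⊢
    rwa [mul_pow, mul_assoc, ← mul_assoc (y ^ h), ← mul_pow, mul_inv_cancel₀ hy, one_pow, one_mul]

lemma trace_pow_char (K E : Type*) [Field K] [Field E] [Fintype E] [Algebra K E] (p : ℕ)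
    [Fact p.Prime] [CharP E p] (x : E) :
    Algebra.trace K E (x ^ p) = 0 ↔ Algebra.trace K E x = 0 := by
  have hinj := FaithfulSMul.algebraMap_injective K E
  have : algebraMap K E (Algebra.trace K E (x ^ p)) = (algebraMap K E (Algebra.trace K E x)) ^ p := by
    rw [FiniteField.algebraMap_trace_eq_sum_pow, FiniteField.algebraMap_trace_eq_sum_pow,
      sum_pow_char p]
    refine Finset.sum_congr rfl fun i _ => ?_
    rw [← pow_mul, ← pow_mul, mul_comm]
  rw [← map_eq_zero_iff _ hinj, this, pow_eq_zero_iff (Fact.out : p.Prime).ne_zero,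
    map_eq_zero_iff _ hinj]

lemma nzc_frob {K E : Type*} [Field K] [Field E] [Fintype E] [Algebra K E] (h p : ℕ)
    [Fact p.Prime] [CharP E p] (b : E) : nzc K E h (b ^ p) = nzc K E h b := by
  unfold nzc
  symm
  have hinj : Function.Injective (fun x : E => x ^ p) := frobenius_inj E p
  refine Finset.card_bij (fun x _ => x ^ p) ?_ ?_ ?_
  · intro x hx
    simp only [Finset.mem_filter, Finset.mem_univ, true_and] at hx ⊢
    rw [← pow_mul, mul_comm p h, pow_mul, ← mul_pow, Ne, trace_pow_char]
    exact hx
  · intro x _ x' _ hxx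
    exact hinj hxx
  · intro x hx
    obtain ⟨y, hy⟩ := (Finite.injective_iff_surjective.1 hinj) x
    refine ⟨y, ?_, hy⟩
    simp only [Finset.mem_filter, Finset.mem_univ, true_and] at hx ⊢
    rw [← hy] at hx
    simp only at hx
    rw [← pow_mul, mul_comm p h, pow_mul, ← mul_pow, Ne, trace_pow_char] at hx
    exact hx

lemma nzc_frob_iter {K E : Type*} [Field K] [Field E] [Fintype E] [Algebra K E] (h p : ℕ)
    [Fact p.Prime] [CharP E p] (b : E) (j : ℕ) : nzc K E h (b ^ (p ^ j)) = nzc K E h b := by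
  induction j with
  | zero => simp
  | succ j ih => rw [pow_succ, pow_mul, nzc_frob, ih]

lemma nzc_inv {K E : Type*} [Field K] [Field E] [Fintype E] [Algebra K E] (h p : ℕ)
    [Fact p.Prime] [CharP E p] (b : E) (hb : b ≠ 0) (j : ℕ) (hd : h ∣ p ^ j + 1) :
    nzc K E h (b⁻¹) = nzc K E h b := by
  obtain ⟨k, hk⟩ := hd
  rw [← nzc_mul_pow h b⁻¹ (b ^ k) (pow_ne_zero _ hb), ← pow_mul, mul_comm k h, ← hk, pow_succ',
    ← mul_assoc, inv_mul_cancel₀ hb, one_mul, nzc_frob_iter]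

noncomputable def gsum {E : Type*} [Field E] [Fintype E] (ψ : AddChar E ℂ) (h : ℕ) (b : E) : ℂ :=
  ∑ x : E, ψ (b * x ^ h)

lemma gsum_zero {E : Type*} [Field E] [Fintype E] (ψ : AddChar E ℂ) (h : ℕ) :
    gsum ψ h 0 = Fintype.card E := by
  simp [gsum]

lemma sum_gsum {E : Type*} [Field E] [Fintype E] (ψ : AddChar E ℂ) (hψ : ψ.IsPrimitive) (h : ℕ)
    (hh : h ≠ 0) : ∑ b, gsum ψ h b = Fintype.card E := by
  unfold gsum
  rw [Finset.sum_comm]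
  simp only [AddChar.sum_mulShift _ hψ]
  simp [hh]

lemma sum_gsum_mul {E : Type*} [Field E] [Fintype E] (ψ : AddChar E ℂ) (hψ : ψ.IsPrimitive) (h : ℕ)
    (c : E) : ∑ b, gsum ψ h b * gsum ψ h (b * c) =
      Fintype.card E * ((Finset.univ.filter fun z : E × E => z.1 ^ h + c * z.2 ^ h = 0).card : ℂ) := by
  unfold gsum
  simp only [Finset.sum_mul_sum, ← AddChar.map_add_eq_mul, mul_assoc, ← mul_add]
  rw [Finset.sum_comm]
  have : ∀ y, ∑ x : E, ∑ i, ψ (x * (y ^ h + c * i ^ h)) = ∑ i,  if y ^ h + c * i ^ h = 0 then (Fintype.card E : ℂ) else 0 := by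
    intro y
    rw [Finset.sum_comm]
    refine Finset.sum_congr rfl fun i _ => ?_
    rw [AddChar.sum_mulShift _ hψ]; split_ifs <;> simp
  simp only [this]
  rw [← Fintype.sum_prod_type' (fun y i => if y ^ h + c * i ^ h = 0 then (Fintype.card E : ℂ) else 0), ← Finset.sum_filter]
  simp [mul_comm]

lemma card_pairs {E : Type*} [Field E] [Fintype E] (h : ℕ) (hh : 0 < h) (ζ : E)
    (hζ : IsPrimitiveRoot ζ h) (y₁ : E) (hy₁ : y₁ ^ h = -1) :
    (Finset.univ.filter fun z : E × E => z.1 ^ h + 1 * z.2 ^ h = 0).card =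
      1 + (Fintype.card E - 1) * h := by
  have h1 : ∀ y : E, (Finset.univ.filter fun x : E => x ^ h + 1 * y ^ h = 0).card
      = if y = 0 then 1 else h := by
    intro y
    split_ifs with hy
    · subst hy
      rw [Finset.card_eq_one]
      refine ⟨0, ?_⟩
      ext x; simp [hh.ne']
    · have e : (Finset.univ.filter fun x : E => x ^ h + 1 * y ^ h = 0)
          = (Finset.range h).image (fun i => ζ ^ i * (y₁ * y)) := by
        ext x
        simp only [Finset.mem_filter, Finset.mem_univ, true_and, Finset.mem_image, Finset.mem_range]
        have hy1 : y₁ ≠ 0 := by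
          rintro rfl
          rw [zero_pow hh.ne'] at hy₁
          have : (1 : E) = 0 := by linear_combination hy₁
          exact one_ne_zero this
        have hyy : y₁ * y ≠ 0 := mul_ne_zero hy1 hy
        constructor
        · intro hx
          have : (x / (y₁ * y)) ^ h = 1 := by
            rw [div_pow, mul_pow, hy₁, div_eq_one_iff_eq]
            · linear_combination hx
            · rw [← hy₁, ← mul_pow]; exact pow_ne_zero _ hyy
          have hne : NeZero h := ⟨hh.ne'⟩
          obtain ⟨i, hi, hi'⟩ := hζ.eq_pow_of_pow_eq_one this
          exact ⟨i, hi, by rw [hi']; field_simp⟩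
        · rintro ⟨i, hi, rfl⟩
          rw [mul_pow, mul_pow, ← pow_mul, mul_comm i h, pow_mul, hζ.pow_eq_one, one_pow, hy₁]
          ring
      rw [e, Finset.card_image_of_injOn, Finset.card_range]
      intro i hi k hk hik
      have hy1 : y₁ ≠ 0 := by
        rintro rfl
        rw [zero_pow hh.ne'] at hy₁
        have : (1 : E) = 0 := by linear_combination hy₁
        exact one_ne_zero this
      have := mul_right_cancel₀ (mul_ne_zero hy1 hy) hik
      exact hζ.pow_inj (by simpa using hi) (by simpa using hk) this
  have h2 : (Finset.univ.filter fun z : E × E => z.1 ^ h + 1 * z.2 ^ h = 0).card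
      = ∑ y : E, (Finset.univ.filter fun x : E => x ^ h + 1 * y ^ h = 0).card := by
    simp only [Finset.card_filter]
    rw [Fintype.sum_prod_type_right]
  rw [h2]
  simp only [h1]
  rw [← Finset.add_sum_erase _ _ (Finset.mem_univ (0 : E))]
  rw [if_pos rfl, Finset.sum_congr rfl (g := fun _ => h)]
  · simp [Finset.card_erase_of_mem]
  · intro x hx
    rw [if_neg (Finset.ne_of_mem_erase hx)]

lemma gsum_mul_pow {E : Type*} [Field E] [Fintype E] (ψ : AddChar E ℂ) (h : ℕ) (b y : E)
    (hy : y ≠ 0) : gsum ψ h (b * y ^ h) = gsum ψ h b := by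
  unfold gsum
  refine Fintype.sum_equiv (Equiv.mulLeft₀ y hy) _ _ fun x => ?_
  simp [mul_pow, mul_assoc]

lemma gsum_nzc {K E : Type*} [Field K] [Fintype K] [Field E] [Fintype E] [Algebra K E] (h : ℕ)
    (χ : AddChar K ℂ) (hχ : χ.IsPrimitive)
    (hK : ∀ c : K, c ≠ 0 → ∃ y : E, algebraMap K E c = y ^ h) (hh : h ≠ 0) (b : E) :
    ((Fintype.card K : ℂ) - 1) * gsum (χ.compAddMonoidHom (Algebra.trace K E).toAddMonoidHom) h b =
      ((Fintype.card K : ℂ) - 1) * Fintype.card E - Fintype.card K * nzc K E h b := by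
  set ψ := χ.compAddMonoidHom (Algebra.trace K E).toAddMonoidHom with hψ
  have hψa : ∀ x, ψ x = χ (Algebra.trace K E x) := fun x => rfl
  have h1 : ∀ c : K, c ≠ 0 → gsum ψ h (algebraMap K E c * b) = gsum ψ h b := by
    intro c hc
    obtain ⟨y, hy⟩ := hK c hc
    rw [hy, mul_comm, gsum_mul_pow]
    rintro rfl
    rw [zero_pow hh, map_eq_zero] at hy
    exact hc hy
  have h2 : ∑ c : K, gsum ψ h (algebraMap K E c * b) =
      Fintype.card E + ((Fintype.card K : ℂ) - 1) * gsum ψ h b := by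
    rw [← Finset.add_sum_erase _ _ (Finset.mem_univ (0 : K))]
    rw [map_zero, zero_mul, gsum_zero, Finset.sum_congr rfl (g := fun _ => gsum ψ h b)]
    · rw [Finset.sum_const, Finset.card_erase_of_mem (Finset.mem_univ _), Finset.card_univ,
        nsmul_eq_mul, Nat.cast_sub Fintype.card_pos, Nat.cast_one]
    · intro c hc
      exact h1 c (Finset.ne_of_mem_erase hc)
  have h3 : ∑ c : K, gsum ψ h (algebraMap K E c * b) =
      Fintype.card K * ((Fintype.card E : ℂ) - nzc K E h b) := by
    unfold gsum
    rw [Finset.sum_comm]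
    have e : ∀ x : E, ∑ c : K, ψ (algebraMap K E c * b * x ^ h)
        = (Fintype.card K : ℂ) * (1 - if Algebra.trace K E (b * x ^ h) ≠ 0 then 1 else 0) := by
      intro x
      simp only [hψa, mul_assoc]
      simp only [← Algebra.smul_def, map_smul, smul_eq_mul]
      rw [AddChar.sum_mulShift _ hχ]
      by_cases hx : Algebra.trace K E (b * x ^ h) = 0 <;> simp [hx]
    simp only [e]
    rw [← Finset.mul_sum, Finset.sum_sub_distrib]
    rw [nzc, Finset.card_filter]
    simp
  linear_combination h3 - h2

lemma sum_units_add {E M : Type*} [Field E] [Fintype E] [AddCommMonoid M] (g : E → M) :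
    ∑ x : E, g x = g 0 + ∑ u : Eˣ, g u := by
  rw [← Finset.add_sum_erase _ _ (Finset.mem_univ (0 : E))]
  congr 1
  symm
  refine Finset.sum_bij (fun u _ => (u : E)) ?_ ?_ ?_ ?_
  · intro u _; simp
  · intro u _ v _ huv; exact Units.ext huv
  · intro x hx
    exact ⟨Units.mk0 x (Finset.ne_of_mem_erase hx), Finset.mem_univ _, rfl⟩
  · intros; rfl

theorem core {K E : Type*} [Field K] [Fintype K] [Field E] [Fintype E] [Algebra K E]
    (p j γ h C : ℕ) [Fact p.Prime] (hcard : Fintype.card E = p ^ (2 * j * γ))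
    (hj : 0 < j) (hγ : 0 < γ) (hh2 : 2 ≤ h) (hd : h ∣ p ^ j + 1)
    (hC : Fintype.card E = h * C + 1)
    (hK : ∀ c : K, c ≠ 0 → ∃ y : E, algebraMap K E c = y ^ h)
    (ζ : E) (hζ : IsPrimitiveRoot ζ h) (w : E → ℕ)
    (hw : ∀ b, nzc K E h b = (Fintype.card K - 1) * h * w b) :
    ∃ u : Eˣ → ℤ, (∀ b, u b = 0 ∨ u b = 1) ∧
      (∀ b : Eˣ, (Fintype.card E : ℤ) - Fintype.card K * h * w b =
        (p : ℤ) ^ (j * γ) * (-1) ^ γ * (1 - h * u b)) ∧ ∑ b, u b = C := by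
  have hp := (Fact.out : p.Prime)
  have hchar : CharP E p := charP_of_card_eq_prime_pow hcard
  have hh0 : h ≠ 0 := by omega
  obtain ⟨χ, hχ1⟩ := (AddChar.exists_apply_ne_zero (a := (1 : K))).2 one_ne_zero
  have hχ : χ.IsPrimitive := AddChar.IsPrimitive.of_ne_one (by rintro rfl; simp at hχ1)
  set ψ := χ.compAddMonoidHom (Algebra.trace K E).toAddMonoidHom with hψdef
  have hψ : ψ.IsPrimitive := by
    refine AddChar.IsPrimitive.of_ne_one ?_
    intro h1
    obtain ⟨x, hx⟩ := Algebra.trace_surjective K E 1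
    have : ψ x = χ (Algebra.trace K E x) := rfl
    rw [h1, hx] at this
    exact hχ1 this.symm
  have hq1 : 1 < Fintype.card K := Fintype.one_lt_card
  set f : E → ℤ := fun b => (Fintype.card E : ℤ) - Fintype.card K * h * w b with hf
  have hfg : ∀ b, (f b : ℂ) = gsum ψ h b := by
    intro b
    have h1 := gsum_nzc h χ hχ hK hh0 b
    rw [hw, Nat.cast_mul, Nat.cast_mul, Nat.cast_sub hq1.le, Nat.cast_one] at h1
    have h2 : ((Fintype.card K : ℂ) - 1) ≠ 0 := by
      rw [sub_ne_zero]; exact_mod_cast hq1.ne'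
    apply mul_left_cancel₀ h2
    rw [h1]
    simp only [hf]; push_cast; ring
  have hf0 : f 0 = Fintype.card E := by
    have := hfg 0
    rw [gsum_zero] at this
    exact_mod_cast this
  have hfinv : ∀ b : E, b ≠ 0 → f b⁻¹ = f b := by
    intro b hb
    have := nzc_inv (K := K) h p b hb j hd
    rw [hw, hw] at this
    have h3 : w b⁻¹ = w b := by
      refine Nat.eq_of_mul_eq_mul_left ?_ this
      exact Nat.mul_pos (by omega) (by omega)
    simp only [hf, h3]
  have hsum : ∑ b : Eˣ, f b = 0 := by
    have h1 := sum_gsum ψ hψ h hh0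
    simp only [← hfg] at h1
    have h2 : ∑ b : E, f b = Fintype.card E := by exact_mod_cast h1
    rw [sum_units_add, hf0] at h2
    linarith
  have hconv : ∀ c : E, ∑ b : Eˣ, f b * f (b * c) = Fintype.card E *
      ((Finset.univ.filter fun z : E × E => z.1 ^ h + c * z.2 ^ h = 0).card : ℤ)
      - Fintype.card E * Fintype.card E := by
    intro c
    have h1 := sum_gsum_mul ψ hψ h c
    simp only [← hfg] at h1
    have h2 : ∑ b : E, f b * f (b * c) = Fintype.card E *
      ((Finset.univ.filter fun z : E × E => z.1 ^ h + c * z.2 ^ h = 0).card : ℤ) := by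
      exact_mod_cast h1
    rw [sum_units_add, zero_mul, hf0] at h2
    linarith
  have hr : (Fintype.card E : ℤ) = (p : ℤ) ^ (j * γ) * (p : ℤ) ^ (j * γ) := by
    rw [hcard]; push_cast; rw [← pow_add]; congr 1; ring
  have hcardU : Fintype.card Eˣ = h * C := by
    rw [Fintype.card_units, hC]; simp
  have hdvd : ∀ b : Eˣ, (p : ℤ) ^ (j * γ) ∣ f b := by
    refine conv_dvd p ?_ (j * γ) (fun b : Eˣ => f b) ?_
    · rw [Nat.coprime_comm, hp.coprime_iff_not_dvd, hcardU]
      intro hdv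
      have : p ∣ h * C + 1 := by
        rw [← hC, hcard]
        exact dvd_pow_self _ (by positivity)
      have := (Nat.dvd_add_right hdv).1 this
      exact hp.one_lt.ne' (Nat.dvd_one.1 this)
    · intro c
      have e : ∑ b : Eˣ, f b * f ((b⁻¹ * c : Eˣ) : E) = ∑ b : Eˣ, f b * f (b * ((c⁻¹ : Eˣ) : E)) := by
        refine Finset.sum_congr rfl fun b _ => ?_
        congr 1
        rw [← hfinv _ (Units.ne_zero _)]
        congr 1
        push_cast
        rw [mul_inv, inv_inv]
      rw [e, hconv, ← mul_sub]
      refine Dvd.dvd.mul_right ?_ _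
      rw [hr, ← pow_add, two_mul]
  obtain ⟨y₁, hy₁⟩ := hK (-1) (by simp)
  rw [map_neg, map_one] at hy₁
  have hsq : ∑ b : Eˣ, f b * f b = (C : ℤ) * h * ((p : ℤ) ^ (j * γ) * (p : ℤ) ^ (j * γ)) * (h - 1) := by
    have h1 := hconv 1
    rw [card_pairs h (by omega) ζ hζ y₁ hy₁.symm] at h1
    simp only [mul_one] at h1
    rw [h1, ← hr, hC]
    push_cast
    ring
  refine two_valued (fun b : Eˣ => f b) ((p : ℤ) ^ (j * γ)) h ((-1) ^ γ) C (by exact_mod_cast hh2)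
    ?_ ?_ ?_ hdvd ?_ ?_ hsum hsq
  · have : 2 ≤ p ^ (j * γ) := le_trans hp.two_le (Nat.le_self_pow (by positivity) p)
    exact_mod_cast this
  · rw [← mul_pow]; simp
  · rw [pow_mul]
    refine dvd_trans ?_ (sub_dvd_pow_sub_pow _ _ γ)
    rw [sub_neg_eq_add]
    exact_mod_cast hd
  · intro b
    simp only [hf, hC]
    refine ⟨C - Fintype.card K * w b, ?_⟩
    push_cast; ring
  · rw [hcardU]; push_cast; ring

lemma sum_range_periodic (N k : ℕ) (g : ℕ → ℕ) (hg : ∀ i, g (i + N) = g i) :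
    ∑ i ∈ Finset.range (k * N), g i = k * ∑ i ∈ Finset.range N, g i := by
  have hg' : ∀ k i, g (k * N + i) = g i := by
    intro k
    induction k with
    | zero => simp
    | succ k ih => intro i; rw [show (k + 1) * N + i = (k * N + i) + N by ring, hg, ih]
  induction k with
  | zero => simp
  | succ k ih =>
    rw [Nat.succ_mul, Finset.sum_range_add, ih]
    simp only [hg']
    ring

lemma omega_prim {E : Type*} [Field E] [Fintype E] (ω : E) (hc : 2 < Fintype.card E)
    (hω : ∀ x : E, x ≠ 0 → ∃ k : ℕ, x = ω ^ k) : IsPrimitiveRoot ω (Fintype.card E - 1) := by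
  have h0 : ω ≠ 0 := by
    rintro rfl
    obtain ⟨x, hx⟩ : ∃ x : E, x ∉ ({0, 1} : Finset E) := by
      by_contra! hcon
      have h1 := Finset.card_le_card (fun x _ => hcon x : (Finset.univ : Finset E) ⊆ {0, 1})
      have h2 := Finset.card_le_two (a := (0 : E)) (b := 1)
      rw [Finset.card_univ] at h1
      omega
    simp only [Finset.mem_insert, Finset.mem_singleton, not_or] at hx
    obtain ⟨k, hk⟩ := hω x hx.1
    rcases k with _ | k
    · exact hx.2 (by simpa using hk)
    · exact hx.1 (by simpa using hk)
  have h1 : orderOf (Units.mk0 ω h0) = Nat.card Eˣ := by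
    apply orderOf_eq_card_of_forall_mem_zpowers
    intro x
    obtain ⟨k, hk⟩ := hω x x.ne_zero
    refine ⟨k, ?_⟩
    ext; simp [hk]
  rw [Nat.card_eq_fintype_card, Fintype.card_units, ← orderOf_units] at h1
  rw [← h1]
  exact IsPrimitiveRoot.orderOf ω

lemma const_pow {K E : Type*} [Field K] [Fintype K] [Field E] [Fintype E] [Algebra K E] (ω : E)
    (hω : ∀ x : E, x ≠ 0 → ∃ k : ℕ, x = ω ^ k) (hprim : IsPrimitiveRoot ω (Fintype.card E - 1))
    (h N : ℕ) (hN : Fintype.card E - 1 = (Fintype.card K - 1) * (h * N)) (c : K) (hc0 : c ≠ 0) :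
    ∃ y : E, algebraMap K E c = y ^ h := by
  obtain ⟨k, hk⟩ := hω (algebraMap K E c) (by simpa using hc0)
  have h1 : ω ^ (k * (Fintype.card K - 1)) = 1 := by
    rw [pow_mul, ← hk, ← map_pow, FiniteField.pow_card_sub_one_eq_one c hc0, map_one]
  have h2 := (hprim.pow_eq_one_iff_dvd _).1 h1
  rw [hN, mul_comm k] at h2
  have hq1 : 1 < Fintype.card K := Fintype.one_lt_card
  have h3 := Nat.dvd_of_mul_dvd_mul_left (by omega) h2
  obtain ⟨l, hl⟩ := dvd_trans (dvd_mul_right h N) h3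
  exact ⟨ω ^ l, by rw [hk, hl, ← pow_mul, mul_comm]⟩

lemma mem_const {K E : Type*} [Field K] [Fintype K] [Field E] [Algebra K E] (θ : E)
    (hθ : θ ^ (Fintype.card K - 1) = 1) : ∃ c : K, c ≠ 0 ∧ algebraMap K E c = θ := by
  obtain ⟨g, hg⟩ := IsCyclic.exists_generator (α := Kˣ)
  have h1 := orderOf_eq_card_of_forall_mem_zpowers hg
  rw [Nat.card_eq_fintype_card, Fintype.card_units, ← orderOf_units,
    ← orderOf_injective (algebraMap K E).toMonoidHom (algebraMap K E).injective] at h1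
  have hq1 : 1 < Fintype.card K := Fintype.one_lt_card
  have hne : NeZero (Fintype.card K - 1) := ⟨by omega⟩
  have h2 := IsPrimitiveRoot.orderOf ((algebraMap K E).toMonoidHom (g : K))
  rw [h1] at h2
  obtain ⟨i, _, hi⟩ := h2.eq_pow_of_pow_eq_one hθ
  refine ⟨(g : K) ^ i, pow_ne_zero _ g.ne_zero, ?_⟩
  rw [map_pow]; exact hi

/-- number of `i < N` with nonzero trace -/
noncomputable def wcnt (K E : Type*) [Field K] [Field E] [Algebra K E] (ω : E) (h N : ℕ) (b : E) : ℕ :=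
  ∑ i ∈ Finset.range N, if Algebra.trace K E (b * ω ^ (h * i)) ≠ 0 then 1 else 0

lemma wcnt_mul {K E : Type*} [Field K] [Fintype K] [Field E] [Algebra K E] (ω : E)
    (h N : ℕ) (hθ : ω ^ ((h * N) * (Fintype.card K - 1)) = 1) (k : ℕ) (b : E) :
    wcnt K E ω h (k * N) b = k * wcnt K E ω h N b := by
  unfold wcnt
  refine sum_range_periodic N k
    (fun i => if Algebra.trace K E (b * ω ^ (h * i)) ≠ 0 then 1 else 0) ?_
  intro i
  rw [pow_mul] at hθ
  obtain ⟨c, hc0, hc⟩ := mem_const (K := K) _ hθ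
  have : b * ω ^ (h * (i + N)) = c • (b * ω ^ (h * i)) := by
    rw [Algebra.smul_def, hc, mul_add, pow_add]; ring
  simp only [this, map_smul, smul_eq_mul, ne_eq, mul_eq_zero, hc0, false_or]

lemma nzc_eq_wcnt {K E : Type*} [Field K] [Field E] [Fintype E] [Algebra K E] (ω : E)
    (hprim : IsPrimitiveRoot ω (Fintype.card E - 1))
    (h : ℕ) (hh : h ≠ 0) (b : E) :
    nzc K E h b = wcnt K E ω h (Fintype.card E - 1) b := by
  have hr : 1 < Fintype.card E := Fintype.one_lt_card
  have hne : NeZero (Fintype.card E - 1) := ⟨by omega⟩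
  have h0 : ω ≠ 0 := hprim.ne_zero (by omega)
  unfold nzc wcnt
  rw [← Finset.card_filter]
  symm
  refine Finset.card_bij (fun i _ => ω ^ i) ?_ ?_ ?_
  · intro i hi
    simp only [Finset.mem_filter, Finset.mem_univ, true_and] at hi ⊢
    rw [← pow_mul, mul_comm i h]; exact hi.2
  · intro i hi k hk hik
    simp only [Finset.mem_filter, Finset.mem_range] at hi hk
    exact hprim.pow_inj hi.1 hk.1 hik
  · intro x hx
    simp only [Finset.mem_filter, Finset.mem_univ, true_and] at hx
    have hx0 : x ≠ 0 := by
      rintro rfl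
      simp [hh] at hx
    obtain ⟨i, hi, hi'⟩ := hprim.eq_pow_of_pow_eq_one (FiniteField.pow_card_sub_one_eq_one x hx0)
    refine ⟨i, ?_, hi'⟩
    simp only [Finset.mem_filter, Finset.mem_range]
    refine ⟨hi, ?_⟩
    rw [← hi', ← pow_mul, mul_comm i h] at hx
    exact hx

lemma card_trace_ne {K E : Type*} [Field K] [Fintype K] [Field E] [Fintype E] [Algebra K E]
    (a : E) (ha : a ≠ 0) (t : K) (m : ℕ) (hm : 0 < m) (hc : Fintype.card E = Fintype.card K ^ m) :
    (Finset.univ.filter fun x : E => Algebra.trace K E (a * x) + t ≠ 0).card =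
      Fintype.card K ^ (m - 1) * (Fintype.card K - 1) := by
  let F : K → ℕ := fun t => (Finset.univ.filter fun x : E => Algebra.trace K E (a * x) + t = 0).card
  have hF : ∀ t, F t = F 0 := by
    intro t
    obtain ⟨y, hy⟩ := Algebra.trace_surjective K E t
    have hy' : Algebra.trace K E (a * (a⁻¹ * y)) = t := by
      rw [← mul_assoc, mul_inv_cancel₀ ha, one_mul, hy]
    refine Finset.card_bij (fun x _ => x + a⁻¹ * y) ?_ ?_ ?_
    · intro x hx
      simp only [Finset.mem_filter, Finset.mem_univ, true_and] at hx ⊢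
      rw [mul_add, map_add, hy', hx, add_zero]
    · intro x _ x' _ hxx; exact add_right_cancel hxx
    · intro x hx
      simp only [Finset.mem_filter, Finset.mem_univ, true_and, add_zero] at hx
      refine ⟨x - a⁻¹ * y, ?_, by ring⟩
      simp only [Finset.mem_filter, Finset.mem_univ, true_and]
      rw [mul_sub, map_sub, hy', hx]; ring
  have h1 : Fintype.card E = ∑ t : K, F t := by
    rw [← Finset.card_univ, Finset.card_eq_sum_card_fiberwise
      (f := fun x : E => - Algebra.trace K E (a * x)) (t := Finset.univ) (by intro x _; simp)]
    refine Finset.sum_congr rfl fun t _ => ?_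
    simp only [F]
    congr 1
    ext x
    simp only [Finset.mem_filter, Finset.mem_univ, true_and]
    constructor
    · intro hx; rw [← hx]; ring
    · intro hx; linear_combination -hx
  simp only [hF, Finset.sum_const, Finset.card_univ, smul_eq_mul] at h1
  obtain ⟨m', rfl⟩ : ∃ m', m = m' + 1 := ⟨m - 1, by omega⟩
  have hq1 : 1 < Fintype.card K := Fintype.one_lt_card
  rw [hc, pow_succ'] at h1
  have h2 := Nat.eq_of_mul_eq_mul_left (by omega) h1
  have h3 := Finset.card_filter_add_card_filter_not (s := (Finset.univ : Finset E))
    (fun x : E => Algebra.trace K E (a * x) + t = 0)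
  rw [Finset.card_univ, hc] at h3
  have h4 : F t = (Finset.univ.filter fun x : E => Algebra.trace K E (a * x) + t = 0).card := rfl
  rw [← h4, hF, ← h2] at h3
  simp only [Nat.add_sub_cancel]
  rw [Nat.mul_sub, mul_one, ← pow_succ, ← h3]
  simp

lemma hammingNorm_cword_ne {Kq E1 E : Type*} [Field Kq] [Fintype Kq] [DecidableEq Kq]
    [Field E1] [Fintype E1] [Field E]
    [Algebra Kq E1] [Algebra Kq E] [Algebra E1 E] (ω : E) (h n : ℕ) (a : E1) (b : E)
    (ha : a ≠ 0) (m : ℕ) (hm : 0 < m) (hc : Fintype.card E1 = Fintype.card Kq ^ m) :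
    hammingNorm (cword Kq E1 E ω h n a b) =
      2 * n * Fintype.card Kq ^ (m - 1) * (Fintype.card Kq - 1) := by
  have e : hammingNorm (cword Kq E1 E ω h n a b) = ∑ z : Fin n × Bool,
      (Finset.univ.filter fun x : E1 => cword Kq E1 E ω h n a b (x, z) ≠ 0).card := by
    unfold hammingNorm
    simp only [Finset.card_filter]
    rw [Fintype.sum_prod_type_right]
  rw [e, Finset.sum_congr rfl (g := fun _ => Fintype.card Kq ^ (m - 1) * (Fintype.card Kq - 1))]
  · simp; ring
  · rintro ⟨i, β⟩ _
    cases β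
    · refine Eq.trans ?_ (card_trace_ne a ha
        (Algebra.trace Kq E ((algebraMap E1 E a + b) * ω ^ (h * (i : ℕ)))) m hm hc)
      congr 1
      ext x
      simp [cword]
    · refine Eq.trans ?_ (card_trace_ne a ha
        (Algebra.trace Kq E (b * ω ^ (h * (i : ℕ)))) m hm hc)
      congr 1
      ext x
      simp [cword]

lemma hammingNorm_cword_zero {Kq E1 E : Type*} [Field Kq] [DecidableEq Kq]
    [Field E1] [Fintype E1] [Field E]
    [Algebra Kq E1] [Algebra Kq E] [Algebra E1 E] (ω : E) (h n : ℕ) (b : E) :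
    hammingNorm (cword Kq E1 E ω h n 0 b) = 2 * Fintype.card E1 * wcnt Kq E ω h n b := by
  have e : ∀ z, cword Kq E1 E ω h n 0 b z = Algebra.trace Kq E (b * ω ^ (h * (z.2.1 : ℕ))) := by
    intro z
    simp [cword]
  unfold hammingNorm wcnt
  simp only [e]
  rw [Finset.card_filter, Fintype.sum_prod_type]
  simp only [Fintype.sum_prod_type]
  rw [Finset.sum_range]
  simp only [Fintype.sum_bool, ← two_mul, ← Finset.mul_sum]
  have hk : ∀ c S : ℕ, c = Fintype.card E1 * S → 2 * c = 2 * Fintype.card E1 * S := by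
    intro c S hc
    rw [hc, mul_assoc]
  apply hk
  rw [← smul_eq_mul, ← Finset.card_univ, ← Finset.sum_const]
  refine Finset.sum_congr rfl fun x _ => ?_
  refine Finset.sum_congr rfl fun y _ => ?_
  congr


lemma card_filter_zero {E1 E : Type*} [Field E1] [Fintype E1] [Field E] [Fintype E]
    (P : E1 × E → Prop) (v : Eˣ → Prop) [DecidablePred P] [DecidablePred v] (h1 : ∀ a b, a ≠ 0 → ¬ P (a, b)) (h0 : ¬ P (0, 0))
    (hv : ∀ b : Eˣ, P (0, (b : E)) ↔ v b) :
    (Finset.univ.filter P).card = (Finset.univ.filter v).card := by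
  symm
  refine Finset.card_bij (fun b _ => ((0 : E1), (b : E))) ?_ ?_ ?_
  · intro b hb
    simp only [Finset.mem_filter, Finset.mem_univ, true_and] at hb ⊢
    exact (hv b).2 hb
  · intro b _ c _ hbc
    exact Units.ext (Prod.ext_iff.1 hbc).2
  · rintro ⟨a, b⟩ hab
    simp only [Finset.mem_filter, Finset.mem_univ, true_and] at hab
    by_cases ha : a = 0
    · subst ha
      have hb : b ≠ 0 := by rintro rfl; exact h0 hab
      refine ⟨Units.mk0 b hb, ?_, rfl⟩
      simp only [Finset.mem_filter, Finset.mem_univ, true_and]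
      exact (hv _).1 hab
    · exact absurd hab (h1 a b ha)

/-- distinctness of weights -/
lemma weights_distinct (A s ε h : ℚ) (hA : 0 < A) (hs : 2 ≤ s) (hε : ε = 1 ∨ ε = -1)
    (hh : 2 ≤ h) (hhs : h < s + 1) :
    A * (s * (s + ε * (h - 1))) ≠ A * (s * s - 1) ∧ A * (s * (s - ε)) ≠ A * (s * s - 1) ∧
    A * (s * (s + ε * (h - 1))) ≠ A * (s * (s - ε)) ∧ A * (s * (s + ε * (h - 1))) ≠ 0 ∧
    A * (s * (s - ε)) ≠ 0 ∧ A * (s * s - 1) ≠ 0 := by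
  have hs0 : s ≠ 0 := by positivity
  refine ⟨?_, ?_, ?_, ?_, ?_, ?_⟩
  · intro H
    have := mul_left_cancel₀ hA.ne' H
    rcases hε with rfl | rfl <;> nlinarith
  · intro H
    have := mul_left_cancel₀ hA.ne' H
    rcases hε with rfl | rfl <;> nlinarith
  · intro H
    have := mul_left_cancel₀ hs0 (mul_left_cancel₀ hA.ne' H)
    rcases hε with rfl | rfl <;> linarith
  · refine mul_ne_zero hA.ne' (mul_ne_zero hs0 ?_)
    rcases hε with rfl | rfl <;> intro H <;> linarith
  · refine mul_ne_zero hA.ne' (mul_ne_zero hs0 ?_)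
    rcases hε with rfl | rfl <;> intro H <;> linarith
  · refine mul_ne_zero hA.ne' ?_
    nlinarith

/-- The semiprimitive case for `C_K`: with `q^m = p^{2jγ}`, `h ∣ p^j+1`, `j` minimal,
`2 ≤ h < q^{m/2}+1` (here `q^{m/2} = p^{jγ}`), the code `C_K` is a three-weight
`[2nq^{m_1}, m+m_1]` code with nonzero weights `2nq^{m_1−1}(q−1)` of frequency
`q^{m_1+m}−q^m`, `(2nq^{m/2+m_1−1}(q−1)/(q^m−1))(q^{m/2}+(−1)^γ(h−1))` of frequency
`(q^m−1)/h`, and `(2nq^{m/2+m_1−1}(q−1)/(q^m−1))(q^{m/2}+(−1)^{γ+1})` of frequency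
`(q^m−1)(h−1)/h`. -/
theorem stmt14 (p j γ q m m1 h n : ℕ) (hp : p.Prime)
    (Kq E1 E : Type*)
    [Field Kq] [Fintype Kq] [DecidableEq Kq]
    [Field E1] [Fintype E1] [Field E] [Fintype E]
    [Algebra Kq E1] [Algebra Kq E] [Algebra E1 E] [IsScalarTower Kq E1 E]
    (hq : q = Fintype.card Kq) (hqodd : Odd q)
    (hm1 : m1 ∣ m) (hc1 : Fintype.card E1 = q ^ m1) (hc : Fintype.card E = q ^ m)
    (ω : E) (hω : ∀ x : E, x ≠ 0 → ∃ k : ℕ, x = ω ^ k)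
    (hj : 0 < j) (hγ : 0 < γ) (hqm : q ^ m = p ^ (2 * j * γ))
    (hNdvd : h ∣ p ^ j + 1)
    (hjmin : ∀ j' : ℕ, 0 < j' → h ∣ p ^ j' + 1 → j ≤ j')
    (hh2 : 2 ≤ h) (hhsmall : h < p ^ (j * γ) + 1)
    (hh : h ∣ (q ^ m - 1) / (q - 1))
    (hn0 : 0 < n) (hn : (q ^ m - 1) / (h * (q - 1)) ∣ n) :
    Fintype.card (E1 × Fin n × Bool) = 2 * n * q ^ m1 ∧
    Function.Injective (fun ab : E1 × E => cword Kq E1 E ω h n ab.1 ab.2) ∧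
    (Finset.univ.filter fun ab : E1 × E =>
        hammingNorm (cword Kq E1 E ω h n ab.1 ab.2) =
          2 * n * q ^ (m1 - 1) * (q - 1)).card = q ^ (m1 + m) - q ^ m ∧
    (Finset.univ.filter fun ab : E1 × E =>
        (hammingNorm (cword Kq E1 E ω h n ab.1 ab.2) : ℚ) =
          2 * n * (p : ℚ) ^ (j * γ) * (q : ℚ) ^ (m1 - 1) * ((q : ℚ) - 1) *
              ((p : ℚ) ^ (j * γ) + (-1 : ℚ) ^ γ * ((h : ℚ) - 1)) /
            ((q : ℚ) ^ m - 1)).card = (q ^ m - 1) / h ∧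
    (Finset.univ.filter fun ab : E1 × E =>
        (hammingNorm (cword Kq E1 E ω h n ab.1 ab.2) : ℚ) =
          2 * n * (p : ℚ) ^ (j * γ) * (q : ℚ) ^ (m1 - 1) * ((q : ℚ) - 1) *
              ((p : ℚ) ^ (j * γ) + (-1 : ℚ) ^ (γ + 1)) /
            ((q : ℚ) ^ m - 1)).card = (q ^ m - 1) * (h - 1) / h := by
  have hfact : Fact p.Prime := ⟨hp⟩
  subst hq
  set q := Fintype.card Kq with hqdef
  have hq1 : 1 < q := Fintype.one_lt_card
  have hm1pos : 0 < m1 := by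
    rcases Nat.eq_zero_or_pos m1 with h0 | h0
    · rw [h0, pow_zero] at hc1
      have : 1 < Fintype.card E1 := Fintype.one_lt_card
      omega
    · exact h0
  have hcE : Fintype.card E = p ^ (2 * j * γ) := by rw [hc, hqm]
  have hs2 : 2 ≤ p ^ (j * γ) := le_trans hp.two_le (Nat.le_self_pow (by positivity) p)
  have hrs : Fintype.card E = p ^ (j * γ) * p ^ (j * γ) := by
    rw [hcE, ← pow_add]; congr 1; ring
  have hr4 : 4 ≤ Fintype.card E := by rw [hrs]; nlinarith
  have hprim := omega_prim ω (by omega) hω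
  -- the number N
  obtain ⟨N, hN⟩ := hh
  have hqd : q - 1 ∣ q ^ m - 1 := by simpa using Nat.sub_dvd_pow_sub_pow q 1 m
  have hrN : q ^ m - 1 = (q - 1) * (h * N) := by
    rw [← hN, Nat.mul_div_cancel' hqd]
  have hNdef : (q ^ m - 1) / (h * (q - 1)) = N := by
    rw [hrN, show (q - 1) * (h * N) = (h * (q - 1)) * N by ring]
    exact Nat.mul_div_cancel_left _ (Nat.mul_pos (by omega) (by omega))
  rw [hNdef] at hn
  obtain ⟨k, hk⟩ := hn
  have hcN : Fintype.card E - 1 = (q - 1) * (h * N) := by rw [hc, hrN]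
  have hK := const_pow (K := Kq) ω hω hprim h N hcN
  have hζ : IsPrimitiveRoot (ω ^ ((q - 1) * N)) h :=
    hprim.pow (by omega) (by rw [hcN]; ring)
  have hθ : ω ^ ((h * N) * (q - 1)) = 1 := by
    rw [mul_comm, ← hcN]; exact hprim.pow_eq_one
  have hw : ∀ b, nzc Kq E h b = (Fintype.card Kq - 1) * h * wcnt Kq E ω h N b := by
    intro b
    rw [nzc_eq_wcnt ω hprim h (by omega), hcN, ← mul_assoc, wcnt_mul ω h N hθ]
  have hC : Fintype.card E = h * ((q - 1) * N) + 1 := by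
    have : h * ((q - 1) * N) = (q - 1) * (h * N) := by ring
    omega
  obtain ⟨u, hu01, huf, husum⟩ := core p j γ h ((q - 1) * N) hcE hj hγ hh2 hNdvd hC hK _ hζ
    (wcnt Kq E ω h N) hw
  -- rational quantities
  set s : ℚ := (p : ℚ) ^ (j * γ) with hsdef
  set ε : ℚ := (-1 : ℚ) ^ γ with hεdef
  have hrs' : (q : ℚ) ^ m = s * s := by
    have : q ^ m = p ^ (j * γ) * p ^ (j * γ) := by rw [← hc, hrs]
    rw [hsdef]; exact_mod_cast this
  have hsQ : (2 : ℚ) ≤ s := by rw [hsdef]; exact_mod_cast hs2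
  have hε : ε = 1 ∨ ε = -1 := neg_one_pow_eq_or ℚ γ
  have hhQ : (2 : ℚ) ≤ h := by exact_mod_cast hh2
  have hhs : (h : ℚ) < s + 1 := by rw [hsdef]; exact_mod_cast hhsmall
  have hqQ : (1 : ℚ) < q := by exact_mod_cast hq1
  have hnQ : (0 : ℚ) < n := by exact_mod_cast hn0
  have hr1 : (0 : ℚ) < s * s - 1 := by nlinarith
  set A : ℚ := 2 * n * (q : ℚ) ^ (m1 - 1) * ((q : ℚ) - 1) / (s * s - 1) with hAdef
  have hA : 0 < A := by
    have : (0 : ℚ) < q - 1 := by linarith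
    positivity
  obtain ⟨d1, d2, d3, d4, d5, d6⟩ := weights_distinct A s ε h hA hsQ hε hhQ hhs
  have hW2 : 2 * n * s * (q : ℚ) ^ (m1 - 1) * ((q : ℚ) - 1) * (s + ε * ((h : ℚ) - 1)) /
      ((q : ℚ) ^ m - 1) = A * (s * (s + ε * (h - 1))) := by
    rw [hrs', hAdef]; ring
  have hW3 : 2 * n * s * (q : ℚ) ^ (m1 - 1) * ((q : ℚ) - 1) * (s + (-1 : ℚ) ^ (γ + 1)) /
      ((q : ℚ) ^ m - 1) = A * (s * (s - ε)) := by
    rw [hrs', hAdef, pow_succ]; ring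
  have hwt1N : ∀ (a : E1) (b : E), a ≠ 0 → hammingNorm (cword Kq E1 E ω h n a b) =
      2 * n * q ^ (m1 - 1) * (q - 1) := fun a b ha =>
    hammingNorm_cword_ne ω h n a b ha m1 hm1pos hc1
  have hW1 : ((2 * n * q ^ (m1 - 1) * (q - 1) : ℕ) : ℚ) = A * (s * s - 1) := by
    rw [hAdef, div_mul_cancel₀ _ hr1.ne']
    push_cast [Nat.cast_sub hq1.le]
    ring
  have hwt1 : ∀ (a : E1) (b : E), a ≠ 0 →
      (hammingNorm (cword Kq E1 E ω h n a b) : ℚ) = A * (s * s - 1) := by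
    intro a b ha
    rw [hwt1N a b ha, hW1]
  have hwt00 : hammingNorm (cword Kq E1 E ω h n 0 0) = 0 := by
    rw [hammingNorm_cword_zero]; simp [wcnt]
  have hwt0 : ∀ b : Eˣ, (hammingNorm (cword Kq E1 E ω h n 0 (b : E)) : ℚ) =
      A * (s * s - s * ε * (1 - h * u b)) := by
    intro b
    rw [hammingNorm_cword_zero, hk, mul_comm N k, wcnt_mul ω h N hθ]
    have h1 : ((Fintype.card E : ℤ) : ℚ) - q * h * wcnt Kq E ω h N b =
        s * ε * (1 - h * u b) := by
      rw [hsdef, hεdef]; exact_mod_cast congrArg (Int.cast : ℤ → ℚ) (huf b)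
    rw [hc] at h1
    push_cast at h1
    rw [hrs'] at h1
    rw [← h1]
    have h2 : s * s - 1 = (q - 1) * (h * N) := by
      have : ((q ^ m - 1 : ℕ) : ℚ) = (((q - 1) * (h * N) : ℕ) : ℚ) := by rw [hrN]
      rw [Nat.cast_sub (Nat.one_le_pow _ _ (by omega)), Nat.cast_mul, Nat.cast_sub hq1.le] at this
      push_cast at this
      rw [← hrs', this]
    have h3 : (q : ℚ) ^ m1 = q ^ (m1 - 1) * q := by
      rw [← pow_succ]; congr 1; omega
    have h4 : A * (s * s - 1) = 2 * n * (q : ℚ) ^ (m1 - 1) * ((q : ℚ) - 1) := by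
      rw [hAdef, div_mul_cancel₀ _ hr1.ne']
    rw [hc1]
    push_cast
    rw [h3]
    apply mul_right_cancel₀ hr1.ne'
    have h5 : (n : ℚ) = N * k := by exact_mod_cast hk
    rw [h5] at h4
    rw [show A * (s * s - (s * s - q * h * (wcnt Kq E ω h N b : ℚ))) * (s * s - 1)
      = (A * (s * s - 1)) * (q * h * (wcnt Kq E ω h N b : ℚ)) by ring, h4, h2]
    ring
  have hwtu0 : ∀ b : Eˣ, u b = 0 → (hammingNorm (cword Kq E1 E ω h n 0 (b : E)) : ℚ) =
      A * (s * (s - ε)) := by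
    intro b hb
    rw [hwt0, hb]; push_cast; ring
  have hwtu1 : ∀ b : Eˣ, u b = 1 → (hammingNorm (cword Kq E1 E ω h n 0 (b : E)) : ℚ) =
      A * (s * (s + ε * (h - 1))) := by
    intro b hb
    rw [hwt0, hb]; push_cast; ring
  have hcount1 : (Finset.univ.filter fun b : Eˣ => u b = 1).card = (q - 1) * N := by
    have h1 : ∑ b, u b = ((Finset.univ.filter fun b : Eˣ => u b = 1).card : ℤ) := by
      rw [Finset.card_filter]
      push_cast
      refine Finset.sum_congr rfl fun b _ => ?_
      rcases hu01 b with hb | hb <;> simp [hb]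
    rw [husum] at h1
    exact_mod_cast h1.symm
  have hcount0 : (Finset.univ.filter fun b : Eˣ => u b = 0).card = (h - 1) * ((q - 1) * N) := by
    have h1 := Finset.card_filter_add_card_filter_not (s := (Finset.univ : Finset Eˣ))
      (fun b : Eˣ => u b = 1)
    have h2 : (Finset.univ.filter fun b : Eˣ => ¬ u b = 1) =
        (Finset.univ.filter fun b : Eˣ => u b = 0) := by
      ext b
      simp only [Finset.mem_filter, Finset.mem_univ, true_and]
      rcases hu01 b with hb | hb <;> simp [hb]
    rw [h2, hcount1, Finset.card_univ, Fintype.card_units, hC, Nat.add_sub_cancel] at h1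
    rw [Nat.sub_mul, one_mul]
    omega
  have hCdef : (q ^ m - 1) / h = (q - 1) * N := by
    rw [hrN, show (q - 1) * (h * N) = h * ((q - 1) * N) by ring]
    exact Nat.mul_div_cancel_left _ (by omega)
  have hCdef' : (q ^ m - 1) * (h - 1) / h = (h - 1) * ((q - 1) * N) := by
    rw [hrN, show (q - 1) * (h * N) * (h - 1) = h * ((h - 1) * ((q - 1) * N)) by ring]
    exact Nat.mul_div_cancel_left _ (by omega)
  -- all nonzero pairs have nonzero weight
  have hnz : ∀ (a : E1) (b : E), hammingNorm (cword Kq E1 E ω h n a b) = 0 → a = 0 ∧ b = 0 := by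
    intro a b hab
    have habQ : (hammingNorm (cword Kq E1 E ω h n a b) : ℚ) = 0 := by exact_mod_cast hab
    by_cases ha : a = 0
    · refine ⟨ha, ?_⟩
      subst ha
      by_contra hb
      rcases hu01 (Units.mk0 b hb) with h1 | h1
      · exact d5 ((hwtu0 _ h1).symm.trans habQ)
      · exact d4 ((hwtu1 _ h1).symm.trans habQ)
    · exact absurd ((hwt1 a b ha).symm.trans habQ) d6
  refine ⟨?_, ?_, ?_, ?_, ?_⟩
  · simp [hc1]; ring
  · rintro ⟨a, b⟩ ⟨a', b'⟩ hab
    simp only at hab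
    have hsub : cword Kq E1 E ω h n (a - a') (b - b') = 0 := by
      have : cword Kq E1 E ω h n (a - a') (b - b') =
          cword Kq E1 E ω h n a b - cword Kq E1 E ω h n a' b' := by
        funext z
        simp only [cword, Pi.sub_apply]
        split_ifs
        · simp only [sub_mul, map_sub]; ring
        · simp only [sub_mul, add_mul, map_sub, map_add]; ring
      rw [this, hab, sub_self]
    obtain ⟨h1, h2⟩ := hnz (a - a') (b - b') (by rw [hsub]; exact hammingNorm_zero)
    rw [sub_eq_zero.1 h1, sub_eq_zero.1 h2]
  · have hset : (Finset.univ.filter fun ab : E1 × E =>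
        hammingNorm (cword Kq E1 E ω h n ab.1 ab.2) = 2 * n * q ^ (m1 - 1) * (q - 1)) =
        (Finset.univ.erase (0 : E1)) ×ˢ (Finset.univ : Finset E) := by
      ext ⟨a, b⟩
      simp only [Finset.mem_filter, Finset.mem_univ, true_and, Finset.mem_product,
        Finset.mem_erase, and_true]
      constructor
      · intro hab ha
        subst ha
        have habQ : (hammingNorm (cword Kq E1 E ω h n 0 b) : ℚ) = A * (s * s - 1) := by
          rw [hab, hW1]
        by_cases hb : b = 0
        · subst hb
          rw [hwt00] at habQ
          exact d6 (by rw [← habQ]; simp)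
        · rcases hu01 (Units.mk0 b hb) with h1 | h1
          · exact d2 ((hwtu0 _ h1).symm.trans habQ)
          · exact d1 ((hwtu1 _ h1).symm.trans habQ)
      · exact hwt1N a b
    rw [hset, Finset.card_product, Finset.card_erase_of_mem (Finset.mem_univ _), Finset.card_univ,
      Finset.card_univ, hc1, hc, Nat.sub_mul, one_mul, ← pow_add]
  · rw [hCdef, ← hcount1]
    refine card_filter_zero _ _ ?_ ?_ ?_
    · intro a b ha hab
      rw [hW2] at hab
      exact d1 (hab.symm.trans (hwt1 a b ha))
    · intro hab
      simp only [hW2, hwt00, Nat.cast_zero] at hab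
      exact d4 hab.symm
    · intro b
      simp only [hW2]
      constructor
      · intro hab
        rcases hu01 b with h1 | h1
        · exact absurd (hab.symm.trans (hwtu0 b h1)) d3
        · exact h1
      · exact hwtu1 b
  · rw [hCdef', ← hcount0]
    refine card_filter_zero _ _ ?_ ?_ ?_
    · intro a b ha hab
      rw [hW3] at hab
      exact d2 (hab.symm.trans (hwt1 a b ha))
    · intro hab
      simp only [hW3, hwt00, Nat.cast_zero] at hab
      exact d5 hab.symm
    · intro b
      simp only [hW3]
      constructor
      · intro hab
        rcases hu01 b with h1 | h1
        · exact h1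
        · exact absurd ((hwtu1 b h1).symm.trans hab) d3
      · exact hwtu0 b
end
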